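/- arXiv:1710.04587 — 3 statements merged into one kernel-verified Lean document; each statement's English description precedes it below -/
import Mathlib

section
/- Let n ≥ 2 and let Ω ⊆ ℝ^n be a bounded open convex set with nonempty interior. Then W(Ω) ≥ ω_n^{-2/n} · P(Ω) · V(Ω)^{2/n}; equivalently, λ(Ω) ≥ ω_n^{-2/n}. -/
open MeasureTheory Metric Set Real Bornology

noncomputable section

/-- Volume (Lebesgue measure) of a set in `ℝⁿ`. -/
def vol (n : ℕ) (Ω : Set (EuclideanSpace ℝ (Fin n))) : ℝ :=
  (volume Ω).toReal

/-- Surface area: the `(n-1)`-dimensional Hausdorff measure of the topological boundary. -/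
def perim (n : ℕ) (Ω : Set (EuclideanSpace ℝ (Fin n))) : ℝ :=
  (μH[(n : ℝ) - 1] (frontier Ω)).toReal

/-- Boundary momentum `W(Ω) = ∫_{∂Ω} |x|² dH^{n-1}(x)`. -/
def bmom (n : ℕ) (Ω : Set (EuclideanSpace ℝ (Fin n))) : ℝ :=
  ∫ x in frontier Ω, ‖x‖ ^ 2 ∂μH[(n : ℝ) - 1]

/-- The scale invariant functional `λ(Ω) = W(Ω) / (P(Ω) V(Ω)^{2/n})`. -/
def lamFun (n : ℕ) (Ω : Set (EuclideanSpace ℝ (Fin n))) : ℝ :=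
  bmom n Ω / (perim n Ω * vol n Ω ^ ((2 : ℝ) / n))

/-- `ω_n`: the Lebesgue measure of the unit ball of `ℝⁿ`. -/
def unitBallVol (n : ℕ) : ℝ :=
  (volume (ball (0 : EuclideanSpace ℝ (Fin n)) 1)).toReal

open scoped ENNReal NNReal Pointwise BoundedContinuousFunction

section UniformlyDistributed

variable {X : Type*} [PseudoMetricSpace X] [SecondCountableTopology X]
  [MeasurableSpace X] [BorelSpace X]

theorem measure_ball_mul_lintegral_le {μ ν : Measure X} [IsFiniteMeasure μ] [IsFiniteMeasure ν]
    {ε δ : ℝ≥0} {a b : ℝ≥0∞} (ha : ∀ x, μ (ball x ε) = a) (hb : ∀ x, ν (ball x ε) = b)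
    {f : X → ℝ≥0} (hf : Continuous f) (hδ : ∀ x y, dist x y < ε → dist (f x) (f y) ≤ δ) :
    b * ∫⁻ x, f x ∂μ ≤ a * ∫⁻ x, f x ∂ν + δ * (a * ν univ) := by
  have hm : MeasurableSet {p : X × X | dist p.1 p.2 < ε} :=
    (isOpen_lt (by fun_prop) (by fun_prop)).measurableSet
  have hm1 (x : X) : MeasurableSet {y | dist x y < ε} :=
    (isOpen_lt (by fun_prop) (by fun_prop)).measurableSet
  have hm2 (y : X) : MeasurableSet {x | dist x y < ε} :=
    (isOpen_lt (by fun_prop) (by fun_prop)).measurableSet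
  have hν (x : X) : ν {y | dist x y < ε} = b := by
    rw [← hb x]; congr 1; ext y; simp [dist_comm]
  have hμ (y : X) : μ {x | dist x y < ε} = a := ha y
  have hfm : Measurable fun x ↦ (f x : ℝ≥0∞) := by fun_prop
  calc b * ∫⁻ x, f x ∂μ
      = ∫⁻ x, ∫⁻ y,
          {p : X × X | dist p.1 p.2 < ε}.indicator (fun p ↦ (f p.1 : ℝ≥0∞)) (x, y) ∂ν ∂μ := by
        rw [← lintegral_const_mul _ hfm]
        refine lintegral_congr fun x ↦ ?_
        have : (fun y ↦ {p : X × X | dist p.1 p.2 < ε}.indicator (fun p ↦ (f p.1 : ℝ≥0∞)) (x, y))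
            = {y | dist x y < ε}.indicator fun _ ↦ (f x : ℝ≥0∞) := by
          ext y; simp [indicator]
        rw [this, lintegral_indicator_const (hm1 x), hν, mul_comm]
    _ ≤ ∫⁻ x, ∫⁻ y, {p : X × X | dist p.1 p.2 < ε}.indicator
          (fun p ↦ (f p.2 : ℝ≥0∞) + δ) (x, y) ∂ν ∂μ := by
        refine lintegral_mono fun x ↦ lintegral_mono fun y ↦ ?_
        refine indicator_le_indicator' fun h ↦ ?_
        have h1 := hδ x y h
        rw [NNReal.dist_eq, abs_le] at h1
        have : f x ≤ f y + δ := by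
          rw [← NNReal.coe_le_coe]; push_cast; linarith
        show (f x : ℝ≥0∞) ≤ f y + δ
        exact_mod_cast this
    _ = ∫⁻ y, ∫⁻ x, {p : X × X | dist p.1 p.2 < ε}.indicator
          (fun p ↦ (f p.2 : ℝ≥0∞) + δ) (x, y) ∂μ ∂ν := by
        refine lintegral_lintegral_swap (Measurable.aemeasurable ?_)
        exact Measurable.indicator (by fun_prop) hm
    _ = ∫⁻ y, a * (f y + δ) ∂ν := by
        refine lintegral_congr fun y ↦ ?_
        have : (fun x ↦ {p : X × X | dist p.1 p.2 < ε}.indicator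
            (fun p ↦ (f p.2 : ℝ≥0∞) + δ) (x, y))
            = {x | dist x y < ε}.indicator fun _ ↦ (f y : ℝ≥0∞) + δ := by
          ext y; simp [indicator]
        rw [this, lintegral_indicator_const (hm2 y), hμ, mul_comm]
    _ = a * ∫⁻ x, f x ∂ν + δ * (a * ν univ) := by
        rw [lintegral_const_mul _ (by fun_prop), lintegral_add_right _ (by fun_prop),
          lintegral_const]
        ring

/-- Two finite measures giving all balls of equal radius equal mass are proportional. -/
theorem measure_univ_smul_eq_of_uniformlyDistributed [CompactSpace X] {μ ν : Measure X}
    [IsFiniteMeasure μ] [IsFiniteMeasure ν] (hμ : ∀ x y ε, μ (ball x ε) = μ (ball y ε))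
    (hν : ∀ x y ε, ν (ball x ε) = ν (ball y ε)) [ν.IsOpenPosMeasure] :
    ν univ • μ = μ univ • ν := by
  rcases isEmpty_or_nonempty X with hX | ⟨⟨o⟩⟩
  · ext s; simp [Set.eq_empty_of_isEmpty s]
  have : IsFiniteMeasure (ν univ • μ) := Measure.smul_finite _ (measure_ne_top _ _)
  refine ext_of_forall_lintegral_eq_of_IsFiniteMeasure fun f ↦ ?_
  simp only [lintegral_smul_measure, smul_eq_mul]
  have huc := CompactSpace.uniformContinuous_of_continuous f.continuous
  have key (δ : ℝ≥0) (hδ : 0 < δ) :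
      ν univ * ∫⁻ x, f x ∂μ ≤ μ univ * ∫⁻ x, f x ∂ν + δ * (μ univ * ν univ) ∧
      μ univ * ∫⁻ x, f x ∂ν ≤ ν univ * ∫⁻ x, f x ∂μ + δ * (μ univ * ν univ) := by
    obtain ⟨ε', hε', h⟩ := Metric.uniformContinuous_iff.1 huc δ hδ
    lift ε' to ℝ≥0 using hε'.le with ε
    set a := μ (ball o ε)
    set b := ν (ball o ε)
    have ha : ∀ x, μ (ball x ε) = a := fun x ↦ hμ _ _ _
    have hb : ∀ x, ν (ball x ε) = b := fun x ↦ hν _ _ _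
    have hb0 : b ≠ 0 := (isOpen_ball.measure_pos ν ⟨o, mem_ball_self hε'⟩).ne'
    have hbt : b ≠ ∞ := measure_ne_top _ _
    have h1 := measure_ball_mul_lintegral_le (δ := 0) ha hb (f := 1) continuous_one (by simp)
    have h2 := measure_ball_mul_lintegral_le (δ := 0) hb ha (f := 1) continuous_one (by simp)
    have hab : b * μ univ = a * ν univ := by
      refine le_antisymm ?_ ?_
      · simpa using h1
      · simpa using h2
    have h3 := measure_ball_mul_lintegral_le (δ := δ) ha hb f.continuous fun x y hxy ↦ (h hxy).le
    have h4 := measure_ball_mul_lintegral_le (δ := δ) hb ha f.continuous fun x y hxy ↦ (h hxy).le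
    constructor
    · rw [← ENNReal.mul_le_mul_iff_right hb0 hbt]
      calc b * (ν univ * ∫⁻ x, f x ∂μ) = ν univ * (b * ∫⁻ x, f x ∂μ) := by ring
        _ ≤ ν univ * (a * ∫⁻ x, f x ∂ν + δ * (a * ν univ)) := by gcongr
        _ = (a * ν univ) * (∫⁻ x, f x ∂ν + δ * ν univ) := by ring
        _ = b * (μ univ * ∫⁻ x, f x ∂ν + δ * (μ univ * ν univ)) := by rw [← hab]; ring
    · rw [← ENNReal.mul_le_mul_iff_right hb0 hbt]
      calc b * (μ univ * ∫⁻ x, f x ∂ν) = (b * μ univ) * ∫⁻ x, f x ∂ν := by ring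
        _ = ν univ * (a * ∫⁻ x, f x ∂ν) := by rw [hab]; ring
        _ ≤ ν univ * (b * ∫⁻ x, f x ∂μ + δ * (b * μ univ)) := by gcongr
        _ = b * (ν univ * ∫⁻ x, f x ∂μ + δ * (μ univ * ν univ)) := by ring
  have lim {A B C : ℝ≥0∞} (hC : C ≠ ∞) (h : ∀ δ : ℝ≥0, 0 < δ → A ≤ B + δ * C) : A ≤ B := by
    refine ENNReal.le_of_forall_pos_le_add fun ε hε _ ↦ ?_
    lift C to ℝ≥0 using hC
    refine (h (ε / (C + 1)) (by positivity)).trans ?_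
    gcongr
    rw [← ENNReal.coe_mul, ENNReal.coe_le_coe, div_mul_eq_mul_div, div_le_iff₀ (by positivity)]
    gcongr
    exact le_self_add
  have hC : μ univ * ν univ ≠ ∞ := ENNReal.mul_ne_top (measure_ne_top _ _) (measure_ne_top _ _)
  exact le_antisymm (lim hC fun δ hδ ↦ (key δ hδ).1) (lim hC fun δ hδ ↦ (key δ hδ).2)

end UniformlyDistributed

section Sphere

variable {E : Type*} [NormedAddCommGroup E] [InnerProductSpace ℝ E]

/-- The isometry of the unit sphere induced by a linear isometry of the ambient space. -/
def unitSphereIsometry (e : E ≃ₗᵢ[ℝ] E) : sphere (0 : E) 1 ≃ᵢ sphere (0 : E) 1 where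
  toFun x := ⟨e x, by simp⟩
  invFun x := ⟨e.symm x, by simp⟩
  left_inv x := by simp
  right_inv x := by simp
  isometry_toFun := fun x y ↦ e.isometry x y

theorem exists_unitSphereIsometry_apply_eq (x y : sphere (0 : E) 1) :
    ∃ e : E ≃ₗᵢ[ℝ] E, unitSphereIsometry e x = y :=
  ⟨(ℝ ∙ ((x : E) - y))ᗮ.reflection, Subtype.ext (Submodule.reflection_sub (by simp))⟩

variable [MeasurableSpace E] [BorelSpace E]

theorem hausdorffMeasure_unitSphere_ball_eq (d : ℝ) (x y : sphere (0 : E) 1) (ε : ℝ) :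
    μH[d] (ball x ε) = μH[d] (ball y ε) := by
  obtain ⟨e, rfl⟩ := exists_unitSphereIsometry_apply_eq x y
  rw [← IsometryEquiv.image_ball, IsometryEquiv.hausdorffMeasure_image]

variable [FiniteDimensional ℝ E]

theorem toSphere_ball_eq (x y : sphere (0 : E) 1) (ε : ℝ) :
    (volume : Measure E).toSphere (ball x ε) = (volume : Measure E).toSphere (ball y ε) := by
  obtain ⟨e, rfl⟩ := exists_unitSphereIsometry_apply_eq x y
  rw [Measure.toSphere_apply' _ measurableSet_ball, Measure.toSphere_apply' _ measurableSet_ball,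
    ← IsometryEquiv.image_ball]
  congr 1
  rw [← (e.measurePreserving.measure_preimage_equiv (f := e.toMeasurableEquiv)
    (Ioo (0 : ℝ) 1 • (Subtype.val '' (unitSphereIsometry e '' ball x ε))))]
  congr 1
  ext z
  simp only [Set.mem_smul, mem_image, mem_preimage]
  constructor
  · rintro ⟨t, ht, _, ⟨w, hw, rfl⟩, rfl⟩
    exact ⟨t, ht, e w, ⟨_, ⟨w, hw, rfl⟩, rfl⟩, by simp⟩
  · rintro ⟨t, ht, _, ⟨_, ⟨w, hw, rfl⟩, rfl⟩, h⟩
    refine ⟨t, ht, w, ⟨w, hw, rfl⟩, e.injective ?_⟩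
    rw [map_smul]
    exact h

theorem exists_hausdorffMeasure_unitSphere_eq_smul_toSphere [Nontrivial E] {d : ℝ}
    (hfin : μH[d] (univ : Set (sphere (0 : E) 1)) ≠ ∞) :
    ∃ c : ℝ≥0∞, (μH[d] : Measure (sphere (0 : E) 1)) = c • (volume : Measure E).toSphere := by
  have : IsFiniteMeasure (μH[d] : Measure (sphere (0 : E) 1)) := ⟨hfin.lt_top⟩
  set σ := (volume : Measure E).toSphere
  have h := measure_univ_smul_eq_of_uniformlyDistributed
    (hausdorffMeasure_unitSphere_ball_eq (E := E) d) (toSphere_ball_eq (E := E))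
  have h0 : σ univ ≠ 0 := by
    rw [Ne, Measure.measure_univ_eq_zero]
    exact Measure.toSphere_ne_zero _
  refine ⟨(σ univ)⁻¹ * μH[d] (univ : Set (sphere (0 : E) 1)), ?_⟩
  rw [mul_smul, ← h, ← mul_smul, ENNReal.inv_mul_cancel h0 (measure_ne_top _ _), one_smul]

theorem lintegral_eq_lintegral_toSphere [Nontrivial E] {f : E → ℝ≥0∞} (hf : Measurable f) :
    ∫⁻ x, f x = ∫⁻ s in Ioi (0 : ℝ), ENNReal.ofReal (s ^ (Module.finrank ℝ E - 1)) *
      ∫⁻ θ, f (s • (θ : E)) ∂(volume : Measure E).toSphere := by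
  set σ := (volume : Measure E).toSphere
  have h := (volume : Measure E).measurePreserving_homeomorphUnitSphereProd.lintegral_comp
    (f := fun p : sphere (0 : E) 1 × Ioi (0 : ℝ) ↦ f ((p.2 : ℝ) • (p.1 : E))) (by fun_prop)
  have h1 : ∫⁻ x, f x = ∫⁻ x : ({0}ᶜ : Set E), f x ∂((volume : Measure E).comap (↑)) := by
    rw [lintegral_subtype_comap (measurableSet_singleton _).compl, restrict_compl_singleton]
  have hm : Measurable fun s : ℝ ↦ ∫⁻ θ, f (s • (θ : E)) ∂σ :=
    Measurable.lintegral_prod_right' (f := fun p : ℝ × sphere (0 : E) 1 ↦ f (p.1 • (p.2 : E)))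
      (by fun_prop)
  rw [h1]
  calc _ = _ := lintegral_congr fun x ↦ by
        have : (x : E) ≠ 0 := x.2
        simp [this]
    _ = _ := h
  rw [lintegral_prod_symm' _ (by fun_prop), Measure.volumeIoiPow,
    lintegral_withDensity_eq_lintegral_mul _ (by fun_prop) (by fun_prop)]
  exact lintegral_subtype_comap measurableSet_Ioi fun s ↦
    ENNReal.ofReal (s ^ (Module.finrank ℝ E - 1)) * ∫⁻ θ, f (s • (θ : E)) ∂σ

theorem hausdorffMeasure_inter_sphere [Nontrivial E] {c : ℝ≥0∞}
    (hc : (μH[(Module.finrank ℝ E : ℝ) - 1] : Measure (sphere (0 : E) 1))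
      = c • (volume : Measure E).toSphere) (A : Set E) {s : ℝ} (hs : 0 < s) :
    μH[(Module.finrank ℝ E : ℝ) - 1] (A ∩ sphere 0 s) =
      ENNReal.ofReal (s ^ (Module.finrank ℝ E - 1)) *
        (c * (volume : Measure E).toSphere {θ | s • (θ : E) ∈ A}) := by
  have hpos : 1 ≤ Module.finrank ℝ E := Module.finrank_pos
  have hd : (0 : ℝ) ≤ (Module.finrank ℝ E : ℝ) - 1 := by
    rw [sub_nonneg]; exact_mod_cast hpos
  have hset : A ∩ sphere 0 s = s • (Subtype.val '' {θ : sphere (0 : E) 1 | s • (θ : E) ∈ A}) := by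
    ext x
    simp only [mem_inter_iff, mem_sphere_zero_iff_norm, Set.mem_smul_set, mem_image, mem_ofPred_eq]
    constructor
    · rintro ⟨hx, hxs⟩
      refine ⟨s⁻¹ • x, ⟨⟨s⁻¹ • x, ?_⟩, ?_, rfl⟩, ?_⟩
      · simp [norm_smul, hxs, abs_of_pos hs, hs.ne']
      · simpa [smul_smul, hs.ne'] using hx
      · simp [smul_smul, hs.ne']
    · rintro ⟨_, ⟨θ, hθ, rfl⟩, rfl⟩
      exact ⟨hθ, by simp [norm_smul, abs_of_pos hs]⟩
  rw [hset, Measure.hausdorffMeasure_smul₀ hd hs.ne',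
    isometry_subtype_coe.hausdorffMeasure_image (Or.inl hd), hc, Measure.smul_apply, smul_eq_mul]
  have : (‖s‖₊ ^ ((Module.finrank ℝ E : ℝ) - 1) : ℝ≥0)
      = Real.toNNReal (s ^ (Module.finrank ℝ E - 1)) := by
    ext
    rw [NNReal.coe_rpow, coe_nnnorm, Real.norm_of_nonneg hs.le, Real.coe_toNNReal _ (by positivity),
      ← Real.rpow_natCast, Nat.cast_sub hpos, Nat.cast_one]
  rw [this, ENNReal.smul_def, smul_eq_mul, ENNReal.ofReal]

theorem setLIntegral_hausdorffMeasure_inter_sphere [Nontrivial E] {c : ℝ≥0∞}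
    (hc : (μH[(Module.finrank ℝ E : ℝ) - 1] : Measure (sphere (0 : E) 1))
      = c • (volume : Measure E).toSphere) {A : Set E} (hA : MeasurableSet A)
    {T : Set ℝ} (hT : MeasurableSet T) (hT0 : T ⊆ Ioi 0) {g : ℝ → ℝ≥0∞} (hg : Measurable g) :
    ∫⁻ s in T, g s * μH[(Module.finrank ℝ E : ℝ) - 1] (A ∩ sphere 0 s) =
      c * ∫⁻ x in A ∩ {x | ‖x‖ ∈ T}, g ‖x‖ := by
  have hT' : MeasurableSet {x : E | ‖x‖ ∈ T} := measurable_norm hT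
  rw [← lintegral_indicator (hA.inter hT'), lintegral_eq_lintegral_toSphere
    (Measurable.indicator (by fun_prop) (hA.inter hT'))]
  have hm : Measurable fun s : ℝ ↦ (volume : Measure E).toSphere {θ | s • (θ : E) ∈ A} := by
    refine measurable_measure_prodMk_left (s := {p : ℝ × sphere (0 : E) 1 | p.1 • (p.2 : E) ∈ A}) ?_
    exact (by fun_prop : Measurable fun p : ℝ × sphere (0 : E) 1 ↦ p.1 • (p.2 : E)) hA
  have h1 : ∀ s ∈ Ioi (0 : ℝ), ENNReal.ofReal (s ^ (Module.finrank ℝ E - 1)) *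
      ∫⁻ θ, (A ∩ {x | ‖x‖ ∈ T}).indicator (fun x ↦ g ‖x‖) (s • (θ : E))
        ∂(volume : Measure E).toSphere = T.indicator (fun s ↦
          ENNReal.ofReal (s ^ (Module.finrank ℝ E - 1)) *
            (g s * (volume : Measure E).toSphere {θ | s • (θ : E) ∈ A})) s := by
    intro s hs
    have hs : 0 < s := hs
    have hAs : MeasurableSet {θ : sphere (0 : E) 1 | s • (θ : E) ∈ A} :=
      (by fun_prop : Measurable fun θ : sphere (0 : E) 1 ↦ s • (θ : E)) hA
    by_cases hsT : s ∈ T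
    · rw [indicator_of_mem hsT, ← lintegral_indicator_const hAs]
      congr 1
      refine lintegral_congr fun θ ↦ ?_
      have hθ : s • (θ : E) ∈ A ∩ {x | ‖x‖ ∈ T} ↔ θ ∈ {θ : sphere (0 : E) 1 | s • (θ : E) ∈ A} := by
        simp [norm_smul, abs_of_pos hs, hsT]
      by_cases h : θ ∈ {θ : sphere (0 : E) 1 | s • (θ : E) ∈ A}
      · rw [indicator_of_mem (hθ.2 h), indicator_of_mem h]
        simp [norm_smul, abs_of_pos hs]
      · rw [indicator_of_notMem (mt hθ.1 h), indicator_of_notMem h]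
    · rw [indicator_of_notMem hsT]
      have : ∀ θ : sphere (0 : E) 1,
          (A ∩ {x | ‖x‖ ∈ T}).indicator (fun x ↦ g ‖x‖) (s • (θ : E)) = 0 := fun θ ↦ by
        simp [indicator, norm_smul, abs_of_pos hs, hsT]
      simp [this]
  rw [setLIntegral_congr_fun measurableSet_Ioi h1, setLIntegral_indicator hT,
    inter_eq_left.2 hT0, ← lintegral_const_mul _ (by fun_prop)]
  refine setLIntegral_congr_fun hT fun s hs ↦ ?_
  rw [hausdorffMeasure_inter_sphere hc A (hT0 hs)]
  ring

end Sphere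

section Comparison

variable {E : Type*} [NormedAddCommGroup E] [InnerProductSpace ℝ E]

theorem dist_le_dist_of_inner_nonpos {p q x y : E} (hp : inner ℝ (x - p) (q - p) ≤ 0)
    (hq : inner ℝ (y - q) (p - q) ≤ 0) : dist p q ≤ dist x y := by
  rw [dist_eq_norm, dist_eq_norm]
  have h : ‖p - q‖ ^ 2 ≤ ‖p - q‖ * ‖x - y‖ := by
    calc ‖p - q‖ ^ 2 = inner ℝ (p - q) (p - q) := (real_inner_self_eq_norm_sq _).symm
      _ = inner ℝ (p - q) (x - y) + inner ℝ (x - p) (q - p) + inner ℝ (y - q) (p - q) := by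
        simp only [inner_sub_left, inner_sub_right, real_inner_comm]
        ring
      _ ≤ inner ℝ (p - q) (x - y) := by linarith
      _ ≤ _ := real_inner_le_norm _ _
  by_contra! hlt
  nlinarith [norm_nonneg (x - y)]

variable [MeasurableSpace E] [BorelSpace E]

/-- If every point of `A` has an outward pointing displacement landing in `B`, then `B` has at least
the Hausdorff measure of `A`. -/
theorem hausdorffMeasure_le_of_forall_exists_inner_nonpos {d : ℝ} (hd : 0 ≤ d) {A B : Set E}
    (h : ∀ p ∈ A, ∃ x ∈ B, ∀ q ∈ A, inner ℝ (x - p) (q - p) ≤ 0) : μH[d] A ≤ μH[d] B := by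
  choose! f hfB hf using h
  have hdist : ∀ p ∈ A, ∀ q ∈ A, dist p q ≤ dist (f p) (f q) := fun p hp q hq ↦
    dist_le_dist_of_inner_nonpos (hf p hp q hq) (hf q hq p hp)
  have hinj : InjOn f A := fun p hp q hq hpq ↦ by
    have := hdist p hp q hq
    rwa [hpq, dist_self, dist_le_zero] at this
  have hleft := hinj.leftInvOn_invFunOn
  have hlip : LipschitzOnWith 1 (Function.invFunOn f A) (f '' A) := by
    refine LipschitzOnWith.of_dist_le_mul ?_
    rintro _ ⟨p, hp, rfl⟩ _ ⟨q, hq, rfl⟩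
    rw [hleft hp, hleft hq, NNReal.coe_one, one_mul]
    exact hdist p hp q hq
  calc μH[d] A = μH[d] (Function.invFunOn f A '' (f '' A)) := by rw [hleft.image_image]
    _ ≤ _ := hlip.hausdorffMeasure_image_le hd
    _ = μH[d] (f '' A) := by simp
    _ ≤ μH[d] B := measure_mono (image_subset_iff.2 hfB)

theorem hausdorffMeasure_inter_sphere_le_frontier {d : ℝ} (hd : 0 ≤ d) {Ω : Set E}
    (hbd : IsBounded Ω) (hop : IsOpen Ω) (z : E) {s : ℝ} (hs : 0 < s) :
    μH[d] (Ω ∩ sphere z s) ≤ μH[d] (frontier Ω ∩ {x | s < dist x z}) := by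
  refine hausdorffMeasure_le_of_forall_exists_inner_nonpos hd fun p ⟨hpΩ, hps⟩ ↦ ?_
  have hpz : ‖p - z‖ = s := by rw [← dist_eq_norm]; exact hps
  have hray : ∃ t : ℝ, 0 < t ∧ p + t • (p - z) ∈ frontier Ω := by
    obtain ⟨R, hR⟩ := hbd.subset_ball z
    have hR0 : 0 < R := dist_nonneg.trans_lt (hR hpΩ)
    set γ : ℝ → E := fun t ↦ p + t • (p - z)
    have hγ : Continuous γ := by fun_prop
    have hout : γ (R / s) ∉ Ω := fun hmem ↦ by
      have h1 : dist (γ (R / s)) z < R := hR hmem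
      have h2 : γ (R / s) - z = (1 + R / s) • (p - z) := by simp only [γ]; module
      rw [dist_eq_norm, h2, norm_smul, hpz, Real.norm_of_nonneg (by positivity)] at h1
      have : (1 + R / s) * s = s + R := by field_simp
      linarith
    have hconn : IsPreconnected (γ '' Icc 0 (R / s)) :=
      isPreconnected_Icc.image _ hγ.continuousOn
    obtain ⟨t, ht, hx⟩ : ∃ t ∈ Icc 0 (R / s), γ t ∈ frontier Ω := by
      by_contra! hno
      have hnot {t : ℝ} (ht : t ∈ Icc 0 (R / s)) (hΩ : γ t ∉ Ω) : γ t ∈ (closure Ω)ᶜ := fun hc ↦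
        hno t ht (hop.frontier_eq ▸ ⟨hc, hΩ⟩)
      have hR' : R / s ∈ Icc 0 (R / s) := ⟨by positivity, le_rfl⟩
      obtain ⟨x, -, hx, hx'⟩ := hconn Ω (closure Ω)ᶜ hop isClosed_closure.isOpen_compl
        (by
          rintro _ ⟨t, ht, rfl⟩
          by_cases hΩ : γ t ∈ Ω
          exacts [Or.inl hΩ, Or.inr (hnot ht hΩ)])
        ⟨γ 0, ⟨0, ⟨le_rfl, by positivity⟩, rfl⟩, by simpa [γ] using hpΩ⟩
        ⟨_, ⟨R / s, hR', rfl⟩, hnot hR' hout⟩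
      exact hx' (subset_closure hx)
    refine ⟨t, ht.1.lt_of_ne ?_, hx⟩
    rintro rfl
    rw [hop.frontier_eq] at hx
    exact hx.2 (by simpa [γ] using hpΩ)
  obtain ⟨t, ht, htF⟩ := hray
  refine ⟨_, ⟨htF, ?_⟩, fun q ⟨_, hqs⟩ ↦ ?_⟩
  · have : p + t • (p - z) - z = (1 + t) • (p - z) := by module
    simp only [mem_ofPred_eq]
    rw [dist_eq_norm, this, norm_smul, hpz, Real.norm_of_nonneg (by positivity)]
    nlinarith
  · have hqz : ‖q - z‖ = s := by rw [← dist_eq_norm]; exact hqs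
    have h1 : inner ℝ (p - z) (q - z) ≤ s * s := by
      simpa only [hpz, hqz] using real_inner_le_norm (p - z) (q - z)
    have h2 : q - p = (q - z) - (p - z) := by abel
    rw [add_sub_cancel_left, real_inner_smul_left, h2, inner_sub_right, real_inner_self_eq_norm_sq,
      hpz]
    nlinarith

theorem hausdorffMeasure_frontier_inter_ball_le [CompleteSpace E] {d : ℝ} (hd : 0 ≤ d) {Ω : Set E}
    (hop : IsOpen Ω) (hconv : Convex ℝ Ω) (hne : Ω.Nonempty) (z : E) (s : ℝ) :
    μH[d] (frontier Ω ∩ ball z s) ≤ μH[d] (Ωᶜ ∩ sphere z s) := by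
  refine hausdorffMeasure_le_of_forall_exists_inner_nonpos hd fun p ⟨hpF, hps⟩ ↦ ?_
  have hpΩ : p ∉ Ω := by
    rw [hop.frontier_eq] at hpF
    exact hpF.2
  obtain ⟨f, hf⟩ := geometric_hahn_banach_open_point hconv hop hpΩ
  set ν := (InnerProductSpace.toDual ℝ E).symm f
  have hν (x : E) : inner ℝ ν x = f x := InnerProductSpace.toDual_symm_apply
  have hν0 : ν ≠ 0 := fun h0 ↦ by
    obtain ⟨a, ha⟩ := hne
    have := hf a ha
    rw [← hν, ← hν, h0, inner_zero_left, inner_zero_left] at this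
    exact this.false
  have hfc : ∀ q ∈ closure Ω, f q ≤ f p :=
    closure_minimal (fun a ha ↦ (hf a ha).le) (isClosed_le f.continuous continuous_const)
  have hν' : 0 < ‖ν‖ := norm_pos_iff.2 hν0
  have hs : dist p z < s := hps
  obtain ⟨t, ht, hts⟩ : ∃ t : ℝ, 0 < t ∧ dist (p + t • ν) z = s := by
    have hcont : Continuous fun t : ℝ ↦ dist (p + t • ν) z := by fun_prop
    set R := (s + dist p z) / ‖ν‖
    have hR : 0 ≤ R := div_nonneg (by linarith [dist_nonneg (x := p) (y := z)]) hν'.le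
    have hRs : s ≤ dist (p + R • ν) z := by
      have h1 : dist (p + R • ν) p = s + dist p z := by
        rw [dist_eq_norm, add_sub_cancel_left, norm_smul, Real.norm_of_nonneg hR,
          div_mul_cancel₀ _ hν'.ne']
      have := dist_triangle_right (p + R • ν) p z
      linarith
    obtain ⟨t, ht, hts⟩ := intermediate_value_Icc hR hcont.continuousOn
      (show s ∈ Icc _ _ from ⟨by simpa using hs.le, hRs⟩)
    refine ⟨t, ht.1.lt_of_ne ?_, hts⟩
    rintro rfl
    simp only [zero_smul, add_zero] at hts
    exact hs.ne hts
  refine ⟨p + t • ν, ⟨fun hmem ↦ ?_, hts⟩, fun q ⟨hqF, _⟩ ↦ ?_⟩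
  · have h1 := hf _ hmem
    rw [map_add, map_smul, ← hν ν, real_inner_self_eq_norm_sq, smul_eq_mul] at h1
    have : 0 < t * ‖ν‖ ^ 2 := by positivity
    linarith
  · rw [add_sub_cancel_left, real_inner_smul_left, hν, map_sub]
    exact mul_nonpos_of_nonneg_of_nonpos ht.le (sub_nonpos.2 (hfc q hqF.1))

end Comparison

section Momentum

theorem lintegral_Ioo_two_mul {a b : ℝ} (ha : 0 ≤ a) (hb : 0 ≤ b) :
    ∫⁻ s in Ioo a b, ENNReal.ofReal (2 * s) = ENNReal.ofReal (b ^ 2 - a ^ 2) := by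
  rcases le_total b a with hab | hab
  · rw [Ioo_eq_empty_of_le hab, Measure.restrict_empty, lintegral_zero_measure,
      ENNReal.ofReal_of_nonpos (sub_nonpos.2 (by gcongr))]
  · rw [Measure.restrict_congr_set Ioo_ae_eq_Ioc, ← ofReal_integral_eq_lintegral_ofReal,
      ← intervalIntegral.integral_of_le hab]
    · rw [intervalIntegral.integral_const_mul, integral_id]
      ring_nf
    · exact (by fun_prop : Continuous fun s : ℝ ↦ 2 * s).integrableOn_Ioc
    · filter_upwards [ae_restrict_mem measurableSet_Ioc] with s hs
      have := hs.1
      simp only [Pi.zero_apply]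
      linarith

theorem lintegral_setLIntegral_indicator_snd {E : Type*} [MeasurableSpace E] {m : Measure E}
    [IsFiniteMeasure m] {T : Set ℝ} {S : Set (E × ℝ)} (hS : MeasurableSet S)
    {g : ℝ → ℝ≥0∞} (hg : Measurable g) :
    ∫⁻ x, (∫⁻ s in T, S.indicator (fun p ↦ g p.2) (x, s)) ∂m =
      ∫⁻ s in T, g s * m {x | (x, s) ∈ S} := by
  have hmeas : Measurable (S.indicator fun p ↦ g p.2) := (hg.comp measurable_snd).indicator hS
  rw [lintegral_lintegral_swap (f := fun x s ↦ S.indicator (fun p ↦ g p.2) (x, s))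
    hmeas.aemeasurable]
  refine lintegral_congr fun s ↦ ?_
  exact lintegral_indicator_const (s := {x | (x, s) ∈ S}) (measurable_prodMk_right hS) (g s)

variable {E : Type*} [NormedAddCommGroup E] [MeasurableSpace E] [BorelSpace E]

theorem lintegral_ofReal_sq_norm_sub {m : Measure E} [IsFiniteMeasure m] {r : ℝ} (hr : 0 ≤ r) :
    ∫⁻ x, ENNReal.ofReal (‖x‖ ^ 2 - r ^ 2) ∂m =
      ∫⁻ s in Ioi r, ENNReal.ofReal (2 * s) * m {x | s < ‖x‖} := by
  have hS : MeasurableSet {p : E × ℝ | p.2 < ‖p.1‖} := measurableSet_lt (by fun_prop) (by fun_prop)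
  refine Eq.trans (lintegral_congr fun x ↦ ?_)
    (lintegral_setLIntegral_indicator_snd hS (g := fun s ↦ ENNReal.ofReal (2 * s)) (by fun_prop))
  rw [← lintegral_Ioo_two_mul hr (norm_nonneg x), ← Ioi_inter_Iio, inter_comm,
    ← setLIntegral_indicator measurableSet_Iio]
  rfl

theorem lintegral_ofReal_sub_sq_norm {m : Measure E} [IsFiniteMeasure m] {r : ℝ} (hr : 0 ≤ r) :
    ∫⁻ x, ENNReal.ofReal (r ^ 2 - ‖x‖ ^ 2) ∂m =
      ∫⁻ s in Ioo 0 r, ENNReal.ofReal (2 * s) * m {x | ‖x‖ < s} := by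
  have hS : MeasurableSet {p : E × ℝ | ‖p.1‖ < p.2} := measurableSet_lt (by fun_prop) (by fun_prop)
  refine Eq.trans (lintegral_congr fun x ↦ ?_)
    (lintegral_setLIntegral_indicator_snd hS (g := fun s ↦ ENNReal.ofReal (2 * s)) (by fun_prop))
  have hset : Ioo ‖x‖ r = Ioi ‖x‖ ∩ Ioo 0 r := by
    ext s
    have := norm_nonneg x
    simp only [mem_Ioo, mem_inter_iff, mem_Ioi]
    grind
  rw [← lintegral_Ioo_two_mul (norm_nonneg x) hr, hset, ← setLIntegral_indicator measurableSet_Ioi]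
  rfl

variable [InnerProductSpace ℝ E]

theorem hausdorffMeasure_unitSphere_ne_top {d : ℝ} (hd : 0 ≤ d) {Ω : Set E}
    (hbd : IsBounded Ω) (hop : IsOpen Ω) (hne : Ω.Nonempty) (hfin : μH[d] (frontier Ω) ≠ ∞) :
    μH[d] (univ : Set (sphere (0 : E) 1)) ≠ ∞ := by
  obtain ⟨z, hz⟩ := hne
  obtain ⟨ρ, hρ, hball⟩ := nhds_basis_closedBall.mem_iff.1 (hop.mem_nhds hz)
  have h1 : μH[d] (sphere z ρ) ≤ μH[d] (frontier Ω) := by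
    rw [← inter_eq_right.2 (sphere_subset_closedBall.trans hball)]
    exact (hausdorffMeasure_inter_sphere_le_frontier hd hbd hop z hρ).trans
      (measure_mono inter_subset_left)
  have hlip : LipschitzWith ρ⁻¹.toNNReal fun x : E ↦ ρ⁻¹ • (x - z) :=
    LipschitzWith.of_dist_le_mul fun x y ↦ by
      rw [dist_smul₀, Real.norm_of_nonneg (by positivity), Real.coe_toNNReal _ (by positivity),
        dist_sub_right]
  have hsub : sphere (0 : E) 1 ⊆ (fun x : E ↦ ρ⁻¹ • (x - z)) '' sphere z ρ := by
    intro θ hθ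
    refine ⟨z + ρ • θ, ?_, ?_⟩
    · rw [mem_sphere_zero_iff_norm] at hθ
      simp [norm_smul, hθ, abs_of_pos hρ]
    · simp [smul_smul, hρ.ne']
  rw [← isometry_subtype_coe.hausdorffMeasure_image (Or.inl hd), image_univ, Subtype.range_coe]
  refine ne_top_of_le_ne_top ?_ ((measure_mono hsub).trans (hlip.hausdorffMeasure_image_le hd _))
  exact ENNReal.mul_ne_top (ENNReal.rpow_ne_top_of_nonneg hd ENNReal.coe_ne_top)
    (ne_top_of_le_ne_top hfin h1)

variable [FiniteDimensional ℝ E] [Nontrivial E]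

theorem lintegral_frontier_ofReal_sub_sq_norm_le {Ω : Set E} (hbd : IsBounded Ω) (hop : IsOpen Ω)
    (hconv : Convex ℝ Ω) (hne : Ω.Nonempty)
    (hfin : μH[(Module.finrank ℝ E : ℝ) - 1] (frontier Ω) ≠ ∞)
    {r : ℝ} (hr : 0 < r) (hvol : volume (ball (0 : E) r) = volume Ω) :
    ∫⁻ x in frontier Ω, ENNReal.ofReal (r ^ 2 - ‖x‖ ^ 2) ∂μH[(Module.finrank ℝ E : ℝ) - 1] ≤
      ∫⁻ x in frontier Ω, ENNReal.ofReal (‖x‖ ^ 2 - r ^ 2) ∂μH[(Module.finrank ℝ E : ℝ) - 1] := by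
  set d : ℝ := (Module.finrank ℝ E : ℝ) - 1 with hd_def
  have hd : 0 ≤ d := by
    rw [hd_def, sub_nonneg]
    exact_mod_cast (Module.finrank_pos : 0 < Module.finrank ℝ E)
  obtain ⟨c, hc⟩ := exists_hausdorffMeasure_unitSphere_eq_smul_toSphere
    (hausdorffMeasure_unitSphere_ne_top hd hbd hop hne hfin)
  have : IsFiniteMeasure (μH[d].restrict (frontier Ω)) := ⟨by simpa using hfin.lt_top⟩
  have hg : Measurable fun s : ℝ ↦ ENNReal.ofReal (2 * s) := by fun_prop
  have hnorm (p : E → Prop) :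
      (μH[d].restrict (frontier Ω)) {x | p x} = μH[d] (frontier Ω ∩ {x | p x}) := by
    rw [Measure.restrict_apply' isClosed_frontier.measurableSet, inter_comm]
  have hinner : Ωᶜ ∩ {x | ‖x‖ ∈ Ioo 0 r} ⊆ ball (0 : E) r \ Ω := fun x hx ↦
    ⟨by simpa using hx.2.2, hx.1⟩
  have houter : (Ω \ ball (0 : E) r : Set E) ≤ᵐ[volume] (Ω ∩ {x | ‖x‖ ∈ Ioi r} : Set E) := by
    have h0 : ∀ᵐ x : E, x ∉ sphere (0 : E) r :=
      measure_eq_zero_iff_ae_notMem.1 (Measure.addHaar_sphere _ _ _)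
    filter_upwards [h0] with x hx hxΩ
    refine ⟨hxΩ.1, ?_⟩
    have h1 : ¬ ‖x‖ < r := by simpa using hxΩ.2
    have h2 : ‖x‖ ≠ r := by simpa using hx
    exact lt_of_le_of_ne (not_lt.1 h1) h2.symm
  calc ∫⁻ x in frontier Ω, ENNReal.ofReal (r ^ 2 - ‖x‖ ^ 2) ∂μH[d]
      = ∫⁻ s in Ioo 0 r, ENNReal.ofReal (2 * s) * μH[d] (frontier Ω ∩ {x | ‖x‖ < s}) := by
        simp_rw [lintegral_ofReal_sub_sq_norm hr.le, hnorm]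
    _ ≤ ∫⁻ s in Ioo 0 r, ENNReal.ofReal (2 * s) * μH[d] (Ωᶜ ∩ sphere 0 s) := by
        refine lintegral_mono fun s ↦ ?_
        have := hausdorffMeasure_frontier_inter_ball_le hd hop hconv hne 0 s
        simp only [ball, dist_zero_right] at this
        gcongr
    _ = c * ∫⁻ x in Ωᶜ ∩ {x | ‖x‖ ∈ Ioo 0 r}, ENNReal.ofReal (2 * ‖x‖) :=
        setLIntegral_hausdorffMeasure_inter_sphere hc hop.measurableSet.compl measurableSet_Ioo
          (fun s hs ↦ hs.1) hg
    _ ≤ c * ∫⁻ x in Ωᶜ ∩ {x | ‖x‖ ∈ Ioo 0 r}, ENNReal.ofReal (2 * r) := by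
        gcongr 1
        refine setLIntegral_mono measurable_const fun x hx ↦ ?_
        have : ‖x‖ < r := hx.2.2
        gcongr
    _ ≤ c * (ENNReal.ofReal (2 * r) * volume (ball (0 : E) r \ Ω)) := by
        rw [setLIntegral_const]
        gcongr
    _ = c * (ENNReal.ofReal (2 * r) * volume (Ω \ ball (0 : E) r)) := by
        rw [measure_sdiff_symm measurableSet_ball.nullMeasurableSet
          hop.measurableSet.nullMeasurableSet hvol
          (ne_top_of_le_ne_top measure_ball_lt_top.ne (measure_mono inter_subset_left))]
    _ ≤ c * ∫⁻ x in Ω ∩ {x | ‖x‖ ∈ Ioi r}, ENNReal.ofReal (2 * r) := by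
        rw [setLIntegral_const]
        gcongr 2
        exact measure_mono_ae houter
    _ ≤ c * ∫⁻ x in Ω ∩ {x | ‖x‖ ∈ Ioi r}, ENNReal.ofReal (2 * ‖x‖) := by
        gcongr 1
        refine setLIntegral_mono (by fun_prop) fun x hx ↦ ?_
        have : r < ‖x‖ := hx.2
        gcongr
    _ = ∫⁻ s in Ioi r, ENNReal.ofReal (2 * s) * μH[d] (Ω ∩ sphere 0 s) :=
        (setLIntegral_hausdorffMeasure_inter_sphere hc hop.measurableSet measurableSet_Ioi
          (Ioi_subset_Ioi hr.le) hg).symm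
    _ ≤ ∫⁻ s in Ioi r, ENNReal.ofReal (2 * s) * μH[d] (frontier Ω ∩ {x | s < ‖x‖}) := by
        refine setLIntegral_mono' measurableSet_Ioi fun s hs ↦ ?_
        have := hausdorffMeasure_inter_sphere_le_frontier hd hbd hop 0 (hr.trans hs)
        simp only [dist_zero_right] at this
        gcongr
    _ = ∫⁻ x in frontier Ω, ENNReal.ofReal (‖x‖ ^ 2 - r ^ 2) ∂μH[d] := by
        simp_rw [lintegral_ofReal_sq_norm_sub hr.le, hnorm]

theorem sq_mul_hausdorffMeasure_frontier_le_integral {Ω : Set E} (hbd : IsBounded Ω)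
    (hop : IsOpen Ω) (hconv : Convex ℝ Ω) (hne : Ω.Nonempty)
    {r : ℝ} (hr : 0 < r) (hvol : volume (ball (0 : E) r) = volume Ω) :
    r ^ 2 * (μH[(Module.finrank ℝ E : ℝ) - 1] (frontier Ω)).toReal ≤
      ∫ x in frontier Ω, ‖x‖ ^ 2 ∂μH[(Module.finrank ℝ E : ℝ) - 1] := by
  by_cases hfin : μH[(Module.finrank ℝ E : ℝ) - 1] (frontier Ω) = ∞
  · rw [hfin]
    simpa using integral_nonneg fun x ↦ sq_nonneg ‖x‖
  set m := (μH[(Module.finrank ℝ E : ℝ) - 1] : Measure E).restrict (frontier Ω) with hm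
  have : IsFiniteMeasure m := ⟨by simpa [hm] using (Ne.lt_top hfin)⟩
  have hF : IsCompact (frontier Ω) := hbd.isCompact_closure.of_isClosed_subset isClosed_frontier
    frontier_subset_closure
  have hi : Integrable (fun x ↦ ‖x‖ ^ 2) m :=
    ContinuousOn.integrableOn_of_subset_isCompact (by fun_prop) hF
      isClosed_frontier.measurableSet subset_rfl hfin
  have hi' : Integrable (fun x ↦ ‖x‖ ^ 2 - r ^ 2) m := hi.sub (integrable_const _)
  have key := lintegral_frontier_ofReal_sub_sq_norm_le hbd hop hconv hne hfin hr hvol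
  have h := integral_eq_lintegral_pos_part_sub_lintegral_neg_part hi'
  simp only [neg_sub] at h
  rw [integral_sub hi (integrable_const _), integral_const] at h
  have h2 := ENNReal.toReal_mono (ne_top_of_le_ne_top hi'.2.ne
    (lintegral_mono fun x ↦ Real.ofReal_le_enorm _)) key
  have h3 : m.real univ = (μH[(Module.finrank ℝ E : ℝ) - 1] (frontier Ω)).toReal := by
    simp [m, Measure.real]
  rw [smul_eq_mul, h3] at h
  linarith

end Momentum

/-- for any bounded open convex set `Ω ⊆ ℝⁿ` (n ≥ 2) with nonempty interior,
`W(Ω) ≥ ω_n^{-2/n} P(Ω) V(Ω)^{2/n}`. -/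
theorem weinstock_isoperimetric (n : ℕ) (hn : 2 ≤ n) (Ω : Set (EuclideanSpace ℝ (Fin n)))
    (hbd : IsBounded Ω) (hop : IsOpen Ω) (hconv : Convex ℝ Ω)
    (hint : (interior Ω).Nonempty) :
    bmom n Ω ≥ unitBallVol n ^ (-(2 : ℝ) / n) * perim n Ω * vol n Ω ^ ((2 : ℝ) / n) := by
  have hne : Ω.Nonempty := hint.mono interior_subset
  have hn0 : (n : ℝ) ≠ 0 := by positivity
  have : Nonempty (Fin n) := ⟨⟨0, by omega⟩⟩
  have hV : 0 < vol n Ω := ENNReal.toReal_pos (hop.measure_pos _ hne).ne' hbd.measure_lt_top.ne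
  have hω : 0 < unitBallVol n :=
    ENNReal.toReal_pos (measure_ball_pos _ _ one_pos).ne' measure_ball_lt_top.ne
  set r : ℝ := (vol n Ω / unitBallVol n) ^ ((1 : ℝ) / n) with hr_def
  have hr : 0 < r := by positivity
  have hrn : r ^ n = vol n Ω / unitBallVol n := by
    rw [hr_def, ← Real.rpow_natCast, ← Real.rpow_mul (by positivity), one_div_mul_cancel hn0,
      Real.rpow_one]
  have hr2 : r ^ 2 = unitBallVol n ^ (-(2 : ℝ) / n) * vol n Ω ^ ((2 : ℝ) / n) := by
    rw [hr_def, ← Real.rpow_natCast, ← Real.rpow_mul (by positivity),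
      Real.div_rpow hV.le hω.le, neg_div, Real.rpow_neg hω.le, div_eq_inv_mul]
    norm_num [div_eq_inv_mul, mul_comm]
  have hvol : volume (ball (0 : EuclideanSpace ℝ (Fin n)) r) = volume Ω := by
    rw [Measure.addHaar_ball_of_pos _ _ hr, finrank_euclideanSpace_fin, hrn,
      ← ENNReal.ofReal_toReal (measure_ball_lt_top (μ := volume)
        (x := (0 : EuclideanSpace ℝ (Fin n))) (r := 1)).ne, ← ENNReal.ofReal_mul (by positivity)]
    change ENNReal.ofReal (vol n Ω / unitBallVol n * unitBallVol n) = _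
    rw [div_mul_cancel₀ _ hω.ne', vol, ENNReal.ofReal_toReal hbd.measure_lt_top.ne]
  have h := sq_mul_hausdorffMeasure_frontier_le_integral hbd hop hconv hne hr hvol
  rw [finrank_euclideanSpace_fin, hr2] at h
  calc unitBallVol n ^ (-(2 : ℝ) / n) * perim n Ω * vol n Ω ^ ((2 : ℝ) / n)
      = unitBallVol n ^ (-(2 : ℝ) / n) * vol n Ω ^ ((2 : ℝ) / n) * perim n Ω := by ring
    _ ≤ bmom n Ω := h
end
end

section
/- Let n ≥ 2 and let Ω ⊆ ℝ^n be a bounded open convex set with nonempty interior. Then σ(Ω) · P(Ω) / V(Ω)^{(n-2)/n} ≤ n ω_n^{2/n}; that is, σ(Ω) · P(Ω)/V(Ω)^{(n-2)/n} ≤ σ(B) · P(B)/V(B)^{(n-2)/n} for any ball B. -/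
open MeasureTheory Metric Set Real Bornology

noncomputable section

/-- The first nonzero Steklov eigenvalue, defined variationally as the infimum of Rayleigh
quotients of `C¹` test functions with zero boundary mean and positive boundary `L²` norm. -/
def steklov (n : ℕ) (Ω : Set (EuclideanSpace ℝ (Fin n))) : ℝ :=
  sInf {r : ℝ | ∃ v : EuclideanSpace ℝ (Fin n) → ℝ, ContDiff ℝ 1 v ∧
    (∫ x in frontier Ω, v x ∂μH[(n : ℝ) - 1]) = 0 ∧
    (0 < ∫ x in frontier Ω, (v x) ^ 2 ∂μH[(n : ℝ) - 1]) ∧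
    r = (∫ x in Ω, ‖gradient v x‖ ^ 2) /
        ∫ x in frontier Ω, (v x) ^ 2 ∂μH[(n : ℝ) - 1]}

open Module

variable {E : Type*} [NormedAddCommGroup E] [InnerProductSpace ℝ E] {m : ℕ}

/-- An isometric parametrisation `ι` of the hyperplane `uᗮ` by `ℝ^m`, together with the
corresponding coordinate projection `pr`. -/
structure HyperplaneFrame (m : ℕ) (u : E) where
  ι : EuclideanSpace ℝ (Fin m) →ₗᵢ[ℝ] E
  pr : E →L[ℝ] EuclideanSpace ℝ (Fin m)
  pr_ι : ∀ y, pr (ι y) = y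
  inner_ι : ∀ y, inner ℝ u (ι y) = 0
  decomp : ∀ x, ι (pr x) + inner ℝ u x • u = x

theorem HyperplaneFrame.nonempty [FiniteDimensional ℝ E] (hE : finrank ℝ E = m + 1) {u : E}
    (hu : ‖u‖ = 1) : Nonempty (HyperplaneFrame m u) := by
  have hu0 : u ≠ 0 := by rintro rfl; simp at hu
  have : Fact (finrank ℝ E = m + 1) := ⟨hE⟩
  have e : EuclideanSpace ℝ (Fin m) ≃ₗᵢ[ℝ] (ℝ ∙ u)ᗮ :=
    (OrthonormalBasis.fromOrthogonalSpanSingleton m hu0).repr.symm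
  refine ⟨⟨(ℝ ∙ u)ᗮ.subtypeₗᵢ.comp e.toLinearIsometry,
    (e.symm.toContinuousLinearEquiv : _ →L[ℝ] _).comp (ℝ ∙ u)ᗮ.orthogonalProjectionOnto,
    ?_, ?_, ?_⟩⟩
  · intro y
    simp
  · intro y
    exact Submodule.mem_orthogonal_singleton_iff_inner_right.1 (e y).2
  · intro x
    have := (ℝ ∙ u).starProjection_add_starProjection_orthogonal x
    rw [Submodule.starProjection_unit_singleton ℝ hu] at this
    rw [add_comm]
    simpa using this

namespace HyperplaneFrame

variable {u : E} (f : HyperplaneFrame m u)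

theorem pr_add_smul (hu : ‖u‖ = 1) (y : EuclideanSpace ℝ (Fin m)) (t : ℝ) :
    f.pr (f.ι y + t • u) = y := by
  have h : f.pr u = 0 := by
    have := f.decomp u
    rw [real_inner_self_eq_norm_sq, hu] at this
    have h2 : f.ι (f.pr u) = 0 := by simpa using this
    exact f.ι.injective (by simpa only [map_zero] using h2)
  simp [h, f.pr_ι]

theorem inner_add_smul (hu : ‖u‖ = 1) (y : EuclideanSpace ℝ (Fin m)) (t : ℝ) :
    inner ℝ u (f.ι y + t • u) = t := by
  simp [inner_add_right, inner_smul_right, f.inner_ι, hu]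

theorem norm_sq_add_smul (hu : ‖u‖ = 1) (y : EuclideanSpace ℝ (Fin m)) (t : ℝ) :
    ‖f.ι y + t • u‖ ^ 2 = ‖y‖ ^ 2 + t ^ 2 := by
  rw [norm_add_sq_real, inner_smul_right, real_inner_comm, f.inner_ι, norm_smul, hu]
  simp

theorem lintegral_eq [FiniteDimensional ℝ E] [MeasurableSpace E] [BorelSpace E]
    (hE : finrank ℝ E = m + 1) (hu : ‖u‖ = 1) {h : E → ENNReal}
    (hh : Measurable h) :
    ∫⁻ x, h x = ∫⁻ y : EuclideanSpace ℝ (Fin m), ∫⁻ t : ℝ, h (f.ι y + t • u) := by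
  let L : WithLp 2 (EuclideanSpace ℝ (Fin m) × ℝ) →ₗᵢ[ℝ] E :=
    { toFun := fun p => f.ι p.fst + p.snd • u
      map_add' := fun p q => by simp [add_smul]; abel
      map_smul' := fun c p => by simp [smul_smul]
      norm_map' := fun p => by
        have : ‖f.ι p.fst + p.snd • u‖ ^ 2 = ‖p‖ ^ 2 := by
          rw [f.norm_sq_add_smul hu, WithLp.prod_norm_sq_eq_of_L2]
          simp
        exact (sq_eq_sq₀ (norm_nonneg _) (norm_nonneg _)).1 this }
  have hfr : finrank ℝ (WithLp 2 (EuclideanSpace ℝ (Fin m) × ℝ)) = finrank ℝ E := by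
    rw [hE, LinearEquiv.finrank_eq (WithLp.linearEquiv 2 ℝ _)]
    simp
  let Φ := LinearIsometryEquiv.mk (LinearEquiv.ofInjectiveOfFinrankEq L.toLinearMap
    L.injective hfr) L.norm_map
  have h1 : MeasurePreserving Φ := Φ.measurePreserving
  have h2 := h1.comp (WithLp.volume_preserving_toLp (EuclideanSpace ℝ (Fin m)) ℝ)
  rw [← h2.lintegral_comp hh, Measure.volume_eq_prod]
  refine (lintegral_prod _ (hh.comp h2.measurable).aemeasurable).trans ?_
  rfl

end HyperplaneFrame

/-- The ratio between the (unnormalised) Hausdorff measure and the Lebesgue measure on `ℝ^m`. -/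
theorem exists_hausdorffMeasure_eq_smul_volume (m : ℕ) : ∃ c : ENNReal, c ≠ 0 ∧ c ≠ ⊤ ∧
    (μH[m] : Measure (EuclideanSpace ℝ (Fin m))) = c • volume := by
  let μ : Measure (EuclideanSpace ℝ (Fin m)) := μH[m]
  refine ⟨μ.addHaarScalarFactor volume, ?_, ENNReal.coe_ne_top,
    Measure.isAddLeftInvariant_eq_smul μ volume⟩
  exact_mod_cast (Measure.addHaarScalarFactor_pos_of_isAddHaarMeasure μ volume).ne'

namespace HyperplaneFrame

variable [MeasurableSpace E] [BorelSpace E] {u : E}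

theorem setLIntegral_hausdorffMeasure (f : HyperplaneFrame m u) {c : ENNReal}
    (hc : (μH[m] : Measure (EuclideanSpace ℝ (Fin m))) = c • volume) {b : ℝ} {A : Set E}
    (hA : MeasurableSet A) (hAb : ∀ x ∈ A, inner ℝ u x = b) {g : E → ENNReal}
    (hg : Measurable g) :
    ∫⁻ x in A, g x ∂μH[m] = c * ∫⁻ z, A.indicator g (f.ι z + b • u) := by
  have hiso : Isometry fun z => f.ι z + b • u :=
    (isometry_add_right (b • u)).comp f.ι.isometry
  have hrange : A ⊆ range fun z => f.ι z + b • u := fun x hx =>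
    ⟨f.pr x, by have := f.decomp x; rwa [hAb x hx] at this⟩
  have hmap := hiso.map_hausdorffMeasure (d := m) (Or.inl m.cast_nonneg)
  calc ∫⁻ x in A, g x ∂μH[m]
      = ∫⁻ x in range fun z => f.ι z + b • u, A.indicator g x ∂μH[m] := by
        rw [lintegral_indicator hA, Measure.restrict_restrict hA, inter_eq_left.2 hrange]
    _ = ∫⁻ z, A.indicator g (f.ι z + b • u) ∂μH[m] := by
        rw [← hmap, lintegral_map (hg.indicator hA) hiso.continuous.measurable]
    _ = _ := by rw [hc, lintegral_smul_measure, smul_eq_mul]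

/-- The area formula for the projection along `u` of the hyperplane `⟪ν, x⟫ = b` onto `uᗮ`. -/
theorem lintegral_projection [FiniteDimensional ℝ E] (hE : finrank ℝ E = m + 1) {ν : E}
    (f : HyperplaneFrame m u) (f' : HyperplaneFrame m ν) (hu : ‖u‖ = 1) (hν : ‖ν‖ = 1)
    (hνu : inner ℝ ν u ≠ 0) (b : ℝ) {g : E → ENNReal} (hg : Measurable g) :
    ENNReal.ofReal |inner ℝ ν u| * ∫⁻ z, g (f'.ι z + b • ν) =
      ∫⁻ y, g (f.ι y + ((b - inner ℝ ν (f.ι y)) / inner ℝ ν u) • u) := by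
  set a : ℝ := inner ℝ ν u with ha
  let h : E → ENNReal := fun x => (Icc (0 : ℝ) 1).indicator 1 (inner ℝ ν x) *
    g (x - ((inner ℝ ν x - b) / a) • u)
  have hind : Measurable ((Icc (0 : ℝ) 1).indicator (1 : ℝ → ENNReal)) :=
    measurable_one.indicator measurableSet_Icc
  have hh : Measurable h := by
    refine (hind.comp (by fun_prop)).mul (hg.comp ?_)
    fun_prop
  have h1 : ∫⁻ x, h x = ∫⁻ z, g (f'.ι z + b • ν) := by
    rw [f'.lintegral_eq hE hν hh, lintegral_lintegral_swap]
    · have key : ∀ t : ℝ, ∫⁻ z, h (f'.ι z + t • ν) =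
          (Icc (0 : ℝ) 1).indicator 1 t * ∫⁻ z, g (f'.ι z + b • ν) := by
        intro t
        simp only [h, f'.inner_add_smul hν]
        have hgm : Measurable fun z => g (f'.ι z + t • ν - ((t - b) / a) • u) :=
          hg.comp (by fun_prop)
        rw [lintegral_const_mul _ hgm]
        congr 1
        set w : E := (t - b) • ν - ((t - b) / a) • u with hw
        have hνw : inner ℝ ν w = 0 := by
          simp only [hw, inner_sub_right, inner_smul_right, ← ha, real_inner_self_eq_norm_sq, hν]
          field_simp
          ring
        have hww : f'.ι (f'.pr w) = w := by
          have := f'.decomp w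
          rwa [hνw, zero_smul, add_zero] at this
        rw [← lintegral_add_right_eq_self (fun z => g (f'.ι z + b • ν)) (f'.pr w)]
        refine lintegral_congr fun z => ?_
        rw [map_add, hww, hw]
        congr 1
        module
      simp_rw [key]
      rw [lintegral_mul_const _ hind, lintegral_indicator_one measurableSet_Icc]
      simp
    · exact (hh.comp (by fun_prop)).aemeasurable
  have h2 : ENNReal.ofReal |a| * ∫⁻ x, h x =
      ∫⁻ y, g (f.ι y + ((b - inner ℝ ν (f.ι y)) / a) • u) := by
    rw [f.lintegral_eq hE hu hh, ← lintegral_const_mul']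
    · refine lintegral_congr fun y => ?_
      set α : ℝ := inner ℝ ν (f.ι y) with hα
      have e1 : ∀ t : ℝ, h (f.ι y + t • u) = (Icc (0 : ℝ) 1).indicator 1 (α + t * a) *
          g (f.ι y + ((b - α) / a) • u) := by
        intro t
        simp only [h, inner_add_right, inner_smul_right, ← ha, ← hα]
        congr 2
        rw [add_sub_assoc, ← sub_smul]
        congr 2
        field_simp
        ring
      simp_rw [e1]
      have him : Measurable fun t => (Icc (0 : ℝ) 1).indicator (1 : ℝ → ENNReal) (α + t * a) :=
        hind.comp (by fun_prop)
      rw [lintegral_mul_const _ him, ← mul_assoc]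
      convert one_mul _
      have e2 : (fun t : ℝ => (Icc (0 : ℝ) 1).indicator (1 : ℝ → ENNReal) (α + t * a)) =
          ((fun t : ℝ => t * a) ⁻¹' ((fun s => α + s) ⁻¹' Icc 0 1)).indicator 1 := rfl
      rw [e2, lintegral_indicator_one]
      · rw [Real.volume_preimage_mul_right hνu, measure_preimage_add, Real.volume_Icc,
          ← ENNReal.ofReal_mul (by positivity), ← ENNReal.ofReal_mul (by positivity), abs_inv,
          sub_zero, mul_one, mul_inv_cancel₀ (by simpa using hνu), ENNReal.ofReal_one]
      · exact measurableSet_Icc.preimage (by fun_prop) |>.preimage (by fun_prop)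
    · exact ENNReal.ofReal_ne_top
  rw [← h2, h1]

end HyperplaneFrame

/-- The average of `|⟪x, u⟫|` over `u` in the unit ball is a fixed multiple of `‖x‖`. -/
theorem exists_lintegral_ball_abs_inner [FiniteDimensional ℝ E] [MeasurableSpace E]
    [BorelSpace E] (hE : finrank ℝ E = m + 1) : ∃ A : ENNReal, A ≠ 0 ∧ A ≠ ⊤ ∧
      ∀ x : E, ∫⁻ u in ball (0 : E) 1, ENNReal.ofReal |inner ℝ x u| = A * ENNReal.ofReal ‖x‖ := by
  let A : ENNReal := ∫⁻ y : EuclideanSpace ℝ (Fin m), ∫⁻ t : ℝ,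
    {s : ℝ | ‖y‖ ^ 2 + s ^ 2 < 1}.indicator (fun s => ENNReal.ofReal |s|) t
  have hmeas : ∀ x : E, Measurable fun u => ENNReal.ofReal |inner ℝ x u| := fun x => by fun_prop
  have hunit : ∀ x : E, ‖x‖ = 1 →
      ∫⁻ u in ball (0 : E) 1, ENNReal.ofReal |inner ℝ x u| = A := by
    intro x hx
    obtain ⟨f⟩ := HyperplaneFrame.nonempty hE hx
    rw [← lintegral_indicator measurableSet_ball,
      f.lintegral_eq hE hx ((hmeas x).indicator measurableSet_ball)]
    refine lintegral_congr fun y => lintegral_congr fun t => ?_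
    have h0 : f.ι y + t • x ∈ ball (0 : E) 1 ↔ t ∈ {s : ℝ | ‖y‖ ^ 2 + s ^ 2 < 1} := by
      rw [mem_ball_zero_iff, mem_ofPred_eq, ← f.norm_sq_add_smul hx, sq_lt_one_iff₀ (norm_nonneg _)]
    by_cases h : f.ι y + t • x ∈ ball (0 : E) 1
    · rw [indicator_of_mem h, indicator_of_mem (h0.1 h), f.inner_add_smul hx]
    · rw [indicator_of_notMem h, indicator_of_notMem (mt h0.2 h)]
  have : Nontrivial E := Module.nontrivial_of_finrank_pos (R := ℝ) (by omega)
  obtain ⟨e, he⟩ := exists_norm_eq E zero_le_one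
  refine ⟨A, ?_, ?_, fun x => ?_⟩
  · rw [← hunit e he]
    intro h
    rw [setLIntegral_eq_zero_iff measurableSet_ball (hmeas e)] at h
    have hO : IsOpen (ball (0 : E) 1 ∩ {u | 0 < inner ℝ e u}) :=
      isOpen_ball.inter (isOpen_lt (by fun_prop) (by fun_prop))
    have hne : (ball (0 : E) 1 ∩ {u | 0 < inner ℝ e u}).Nonempty := by
      refine ⟨(1 / 2 : ℝ) • e, ?_, ?_⟩
      · rw [mem_ball_zero_iff, norm_smul, he]; norm_num
      · simp only [mem_ofPred_eq, inner_smul_right, real_inner_self_eq_norm_sq, he]; norm_num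
    refine (hO.measure_pos volume hne).ne' (measure_mono_null ?_ h)
    rintro u ⟨hu1, hu2⟩ hu3
    have := hu3 hu1
    rw [ENNReal.ofReal_eq_zero] at this
    exact absurd (abs_pos.2 (ne_of_gt hu2)) (not_lt.2 this)
  · rw [← hunit e he]
    refine ne_top_of_le_ne_top (measure_ball_lt_top (μ := volume) (x := (0 : E)) (r := 1)).ne ?_
    rw [← setLIntegral_one]
    refine setLIntegral_mono measurable_const fun u hu => ?_
    rw [ENNReal.ofReal_le_one]
    refine (abs_real_inner_le_norm e u).trans ?_
    rw [he, one_mul]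
    exact (mem_ball_zero_iff.1 hu).le
  · rcases eq_or_ne x 0 with rfl | hx
    · simp
    · have hx' : ‖x‖ ≠ 0 := norm_ne_zero_iff.2 hx
      rw [← hunit (‖x‖⁻¹ • x) (by rw [norm_smul, norm_inv, norm_norm, inv_mul_cancel₀ hx']),
        ← lintegral_mul_const' _ _ ENNReal.ofReal_ne_top]
      refine lintegral_congr fun u => ?_
      rw [← ENNReal.ofReal_mul (abs_nonneg _), inner_smul_left, abs_mul]
      congr 1
      simp only [conj_trivial, abs_inv, abs_norm]
      field_simp

theorem lintegral_Ioo_abs {a b : ℝ} (hab : a ≤ b) :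
    ∫⁻ t in Ioo a b, ENNReal.ofReal |t| = ENNReal.ofReal ((b * |b| - a * |a|) / 2) := by
  have hint : IntervalIntegrable (fun t : ℝ => |t|) volume a b :=
    continuous_abs.intervalIntegrable a b
  have h : ∫ t in a..b, |t| = b * |b| / 2 - a * |a| / 2 := by
    refine integral_eq_of_hasDerivAt_off_countable (fun t : ℝ => t * |t| / 2) (fun t => |t|)
      (countable_singleton 0) (by fun_prop) (fun t ht => ?_) hint
    have ht0 : t ≠ 0 := ht.2
    refine (((hasDerivAt_id t).mul (hasDerivAt_abs ht0)).div_const 2).congr_deriv ?_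
    simp only [id_eq, one_mul, self_mul_sign]
    ring
  rw [intervalIntegral.integral_of_le hab, integral_Ioc_eq_integral_Ioo] at h
  rw [← ofReal_integral_eq_lintegral_ofReal, h, sub_div]
  · exact (hint.1).mono_set Ioo_subset_Ioc_self
  · exact Filter.Eventually.of_forall fun t => abs_nonneg t

section Polytope

variable {N : ℕ} (ν : Fin N → E) (b : Fin N → ℝ)

/-- The open polytope `{x | ⟪ν i, x⟫ < b i for all i}`. -/
def openPolytope : Set E := {x | ∀ i, inner ℝ (ν i) x < b i}

/-- The facets of `openPolytope ν b`, made disjoint by attributing each point of the frontier to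
the first constraint it saturates. -/
def polytopeFacet (i : Fin N) : Set E :=
  {x | inner ℝ (ν i) x = b i ∧ x ∈ frontier (openPolytope ν b) ∧ ∀ j < i, inner ℝ (ν j) x ≠ b j}

theorem isOpen_openPolytope : IsOpen (openPolytope ν b) := by
  rw [openPolytope, ofPred_forall]
  exact isOpen_iInter_of_finite fun i => isOpen_lt (by fun_prop) continuous_const

theorem convex_openPolytope : Convex ℝ (openPolytope ν b) := by
  rw [openPolytope, ofPred_forall]
  exact convex_iInter fun i => convex_halfSpace_lt (innerₛₗ ℝ (ν i)).isLinear (b i)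

theorem frontier_openPolytope : frontier (openPolytope ν b) = ⋃ i, polytopeFacet ν b i := by
  refine Subset.antisymm (fun x hx => ?_) (iUnion_subset fun i x hx => hx.2.1)
  have hcl : ∀ i, inner ℝ (ν i) x ≤ b i := by
    intro i
    have : closure (openPolytope ν b) ⊆ {x | inner ℝ (ν i) x ≤ b i} :=
      closure_minimal (fun y hy => (hy i).le) (isClosed_le (by fun_prop) continuous_const)
    exact this hx.1
  have hx2 : x ∉ openPolytope ν b := by
    have := hx.2
    rwa [(isOpen_openPolytope ν b).interior_eq] at this
  have hne : {i | inner ℝ (ν i) x = b i}.Nonempty := by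
    simp only [openPolytope, mem_ofPred_eq, not_forall, not_lt] at hx2
    obtain ⟨i, hi⟩ := hx2
    exact ⟨i, le_antisymm (hcl i) hi⟩
  obtain ⟨i, hi, hmin⟩ := WellFounded.has_min (wellFounded_lt (α := Fin N)) _ hne
  exact mem_iUnion.2 ⟨i, hi, hx, fun j hj hj' => hmin j hj' hj⟩

theorem polytopeFacet_unique {i j : Fin N} {x : E} (hi : x ∈ polytopeFacet ν b i)
    (hj : x ∈ polytopeFacet ν b j) : i = j := by
  rcases lt_trichotomy i j with h | h | h
  · exact absurd hi.1 (hj.2.2 i h)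
  · exact h
  · exact absurd hj.1 (hi.2.2 j h)

theorem measurableSet_polytopeFacet [MeasurableSpace E] [BorelSpace E] (i : Fin N) :
    MeasurableSet (polytopeFacet ν b i) := by
  have h : polytopeFacet ν b i = {x | inner ℝ (ν i) x = b i} ∩ (frontier (openPolytope ν b) ∩
      ⋂ j, ⋂ (_ : j < i), {x | inner ℝ (ν j) x = b j}ᶜ) := by
    ext x
    simp [polytopeFacet]
  have hm : ∀ j, MeasurableSet {x | inner ℝ (ν j) x = b j} := fun j =>
    (isClosed_eq (by fun_prop) continuous_const).measurableSet
  rw [h]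
  exact (hm i).inter (isClosed_frontier.measurableSet.inter
    (MeasurableSet.iInter fun j => MeasurableSet.iInter fun _ => (hm j).compl))

/-- The sum of the values of `G` at the points where the line `x + ℝ u` crosses the facets
transversally. -/
def crossingSum (u : E) (G : E → ENNReal) (x : E) : ENNReal :=
  ∑ i, if inner ℝ (ν i) u = (0 : ℝ) then 0 else
    (polytopeFacet ν b i).indicator G (x + ((b i - inner ℝ (ν i) x) / inner ℝ (ν i) u) • u)

theorem exists_crossingSum_eq (hbd : IsBounded (openPolytope ν b)) {u x : E} (hu : ‖u‖ = 1)
    (hne : ∃ t : ℝ, x + t • u ∈ openPolytope ν b) :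
    ∃ s t : ℝ, s < t ∧ (∀ r : ℝ, x + r • u ∈ openPolytope ν b ↔ r ∈ Ioo s t) ∧
      ∀ G, crossingSum ν b u G x = G (x + s • u) + G (x + t • u) := by
  set P := openPolytope ν b with hP
  have hPo : IsOpen P := isOpen_openPolytope ν b
  have hPc : Convex ℝ P := convex_openPolytope ν b
  let γ : ℝ → E := fun r => x + r • u
  have hγ : Continuous γ := by fun_prop
  let J : Set ℝ := γ ⁻¹' P
  have hJo : IsOpen J := hPo.preimage hγ
  have hJb : IsBounded J := by
    obtain ⟨R, hR⟩ := hbd.subset_closedBall x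
    refine (isBounded_closedBall (x := (0 : ℝ)) (r := R)).subset fun r hr => ?_
    have := hR hr
    simpa [γ, dist_eq_norm, norm_smul, hu] using this
  obtain ⟨t₀, ht₀⟩ := hne
  have hJne : J.Nonempty := ⟨t₀, ht₀⟩
  have hseg : ∀ r, γ r ∈ closure P → ∀ q ∈ openSegment ℝ r t₀, q ∈ J := by
    intro r hr q hq
    have h1 := hPc.openSegment_closure_interior_subset_interior hr
      (by rw [hPo.interior_eq]; exact ht₀)
    rw [hPo.interior_eq] at h1
    refine h1 ?_
    obtain ⟨α, β, hα, hβ, hαβ, rfl⟩ := hq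
    refine ⟨α, β, hα, hβ, hαβ, ?_⟩
    simp only [γ, smul_eq_mul]
    have : x = (α + β) • x := by rw [hαβ, one_smul]
    nth_rewrite 3 [this]
    module
  set s := sInf J
  set t := sSup J
  have hsJ : s ∉ J := fun h => by
    obtain ⟨ε, hε, hsub⟩ := Metric.isOpen_iff.1 hJo s h
    have : s - ε / 2 ∈ J := hsub (by simp [abs_of_pos, hε])
    have := csInf_le hJb.bddBelow this
    linarith
  have htJ : t ∉ J := fun h => by
    obtain ⟨ε, hε, hsub⟩ := Metric.isOpen_iff.1 hJo t h
    have : t + ε / 2 ∈ J := hsub (by simp [abs_of_pos, hε])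
    have := le_csSup hJb.bddAbove this
    linarith
  have hscl : γ s ∈ closure P :=
    closure_mono (image_preimage_subset γ P)
      (image_closure_subset_closure_image hγ ⟨s, csInf_mem_closure hJne hJb.bddBelow, rfl⟩)
  have htcl : γ t ∈ closure P :=
    closure_mono (image_preimage_subset γ P)
      (image_closure_subset_closure_image hγ ⟨t, csSup_mem_closure hJne hJb.bddAbove, rfl⟩)
  have hst₀ : s < t₀ := lt_of_le_of_ne (csInf_le hJb.bddBelow ht₀) fun h => hsJ (h ▸ ht₀)
  have ht₀t : t₀ < t := lt_of_le_of_ne (le_csSup hJb.bddAbove ht₀) fun h => htJ (h ▸ ht₀)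
  have hsIoo : ∀ q ∈ Ioo s t₀, q ∈ J := by
    simpa only [openSegment_eq_Ioo hst₀] using hseg s hscl
  have htIoo : ∀ q ∈ Ioo t₀ t, q ∈ J := by
    simpa only [openSegment_symm ℝ t t₀, openSegment_eq_Ioo ht₀t] using hseg t htcl
  have hfr : ∀ r, γ r ∈ frontier P → r = s ∨ r = t := by
    intro r hr
    have hrJ : r ∉ J := fun h => hr.2 (by rw [hPo.interior_eq]; exact h)
    rcases lt_trichotomy r t₀ with h | h | h
    · left
      have h1 : ∀ q ∈ Ioo r t₀, q ∈ J := by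
        simpa only [openSegment_eq_Ioo h] using hseg r hr.1
      refine le_antisymm (not_lt.1 fun hlt => hrJ (hsIoo r ⟨hlt, h⟩)) (not_lt.1 fun hlt => ?_)
      have := csInf_le hJb.bddBelow (h1 ((r + s) / 2) ⟨by linarith, by linarith⟩)
      linarith
    · exact absurd (h ▸ ht₀) hrJ
    · right
      have h1 : ∀ q ∈ Ioo t₀ r, q ∈ J := by
        simpa only [openSegment_symm ℝ r t₀, openSegment_eq_Ioo h] using hseg r hr.1
      refine le_antisymm (not_lt.1 fun hlt => ?_) (not_lt.1 fun hlt => hrJ (htIoo r ⟨h, hlt⟩))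
      have := le_csSup hJb.bddAbove (h1 ((r + t) / 2) ⟨by linarith, by linarith⟩)
      linarith
  have hJ : ∀ r, r ∈ J ↔ r ∈ Ioo s t := by
    intro r
    refine ⟨fun hr => ⟨lt_of_le_of_ne (csInf_le hJb.bddBelow hr) fun h => hsJ (h ▸ hr),
      lt_of_le_of_ne (le_csSup hJb.bddAbove hr) fun h => htJ (h ▸ hr)⟩, fun hr => ?_⟩
    rcases lt_trichotomy r t₀ with h | h | h
    · exact hsIoo r ⟨hr.1, h⟩
    · exact h ▸ ht₀
    · exact htIoo r ⟨h, hr.2⟩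
  have hfacet : ∀ r, γ r ∈ closure P → r ∉ J → ∃ i, γ r ∈ polytopeFacet ν b i := by
    intro r hr hrJ
    have : γ r ∈ frontier P := ⟨hr, by rwa [hPo.interior_eq]⟩
    rw [hP, frontier_openPolytope] at this
    exact mem_iUnion.1 this
  have hlin : ∀ i r, inner ℝ (ν i) (γ r) = inner ℝ (ν i) x + r * inner ℝ (ν i) u := by
    intro i r
    rw [inner_add_right, real_inner_smul_right]
  have hcross : ∀ i r, γ r ∈ polytopeFacet ν b i → inner ℝ (ν i) u ≠ 0 := by
    intro i r hr h0
    have h1 := hr.1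
    have h2 : inner ℝ (ν i) (γ t₀) < b i := ht₀ i
    rw [hlin, h0] at h1 h2
    linarith
  have htau : ∀ i r, γ r ∈ polytopeFacet ν b i →
      (b i - inner ℝ (ν i) x) / inner ℝ (ν i) u = r := by
    intro i r hr
    have h1 := hr.1
    rw [hlin] at h1
    rw [div_eq_iff (hcross i r hr)]
    linarith
  obtain ⟨i₁, hi₁⟩ := hfacet s hscl hsJ
  obtain ⟨i₂, hi₂⟩ := hfacet t htcl htJ
  have hst : s < t := hst₀.trans ht₀t
  have hne : i₁ ≠ i₂ := by
    rintro rfl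
    exact hst.ne ((htau _ _ hi₁).symm.trans (htau _ _ hi₂))
  refine ⟨s, t, hst, hJ, fun G => ?_⟩
  have hterm : ∀ i, (if inner ℝ (ν i) u = (0 : ℝ) then 0 else
      (polytopeFacet ν b i).indicator G (x + ((b i - inner ℝ (ν i) x) / inner ℝ (ν i) u) • u)) =
      (if i = i₁ then G (γ s) else 0) + (if i = i₂ then G (γ t) else 0) := by
    intro i
    by_cases h1 : i = i₁
    · subst h1
      rw [if_neg (hcross _ _ hi₁), htau _ _ hi₁, if_pos rfl, if_neg hne, add_zero]
      exact indicator_of_mem hi₁ G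
    by_cases h2 : i = i₂
    · subst h2
      rw [if_neg (hcross _ _ hi₂), htau _ _ hi₂, if_pos rfl, if_neg h1, zero_add]
      exact indicator_of_mem hi₂ G
    rw [if_neg h1, if_neg h2, add_zero]
    split_ifs
    · rfl
    refine indicator_of_notMem (fun hmem => ?_) G
    rcases hfr _ hmem.2.1 with h | h
    · rw [h] at hmem
      exact h1 (polytopeFacet_unique ν b hmem hi₁)
    · rw [h] at hmem
      exact h2 (polytopeFacet_unique ν b hmem hi₂)
  simp only [crossingSum, hterm, Finset.sum_add_distrib, Finset.sum_ite_eq', Finset.mem_univ,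
    if_true, γ]

end Polytope

theorem norm_sq_add_sq_lt_iff {Y r ρ : ℝ} (hρ : 0 ≤ ρ) {z : ℝ} (hz : 0 ≤ z)
    (h : z ^ 2 = Y ^ 2 + r ^ 2) : z < ρ ↔ r ∈ Ioo (-√(ρ ^ 2 - Y ^ 2)) √(ρ ^ 2 - Y ^ 2) := by
  rw [mem_Ioo, ← abs_lt, lt_sqrt (abs_nonneg r), sq_abs, ← sq_lt_sq₀ hz hρ, h,
    lt_sub_iff_add_lt, add_comm]

section Direction

variable {N : ℕ} {ν : Fin N → E} {b : Fin N → ℝ} {u : E}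

theorem crossingSum_eq_zero (f : HyperplaneFrame m u) (hu : ‖u‖ = 1)
    {y : EuclideanSpace ℝ (Fin m)} (hy : y ∉ closure (f.pr '' openPolytope ν b))
    (G : E → ENNReal) : crossingSum ν b u G (f.ι y) = 0 := by
  refine Finset.sum_eq_zero fun i _ => ?_
  split_ifs
  · rfl
  refine indicator_of_notMem (fun hmem => hy ?_) G
  have := image_closure_subset_closure_image f.pr.continuous
    (mem_image_of_mem f.pr hmem.2.1.1)
  rwa [f.pr_add_smul hu] at this

theorem lintegral_line_ball (f : HyperplaneFrame m u) (hu : ‖u‖ = 1) {ρ : ℝ} (hρ : 0 ≤ ρ)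
    (y : EuclideanSpace ℝ (Fin m)) :
    2 * ∫⁻ t : ℝ, (ball (0 : E) ρ).indicator (fun x => ENNReal.ofReal |inner ℝ u x|)
      (f.ι y + t • u) = 2 * ENNReal.ofReal (ρ ^ 2 - ‖y‖ ^ 2) := by
  have h : ∀ t : ℝ, (ball (0 : E) ρ).indicator (fun x => ENNReal.ofReal |inner ℝ u x|)
      (f.ι y + t • u) = (Ioo (-√(ρ ^ 2 - ‖y‖ ^ 2)) √(ρ ^ 2 - ‖y‖ ^ 2)).indicator
        (fun t => ENNReal.ofReal |t|) t := by
    intro t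
    have := norm_sq_add_sq_lt_iff hρ (norm_nonneg _)
      (f.norm_sq_add_smul hu y t)
    simp only [indicator, mem_ball_zero_iff, this, f.inner_add_smul hu]
  simp_rw [h]
  rw [lintegral_indicator measurableSet_Ioo,
    lintegral_Ioo_abs (neg_le_self (sqrt_nonneg _)), abs_neg, abs_of_nonneg (sqrt_nonneg _)]
  congr 1
  rcases le_total (ρ ^ 2 - ‖y‖ ^ 2) 0 with h0 | h0
  · rw [sqrt_eq_zero_of_nonpos h0, ENNReal.ofReal_of_nonpos h0]
    simp
  · congr 1
    linear_combination mul_self_sqrt h0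

theorem crossingSum_line_inequality (f : HyperplaneFrame m u) (hu : ‖u‖ = 1)
    (hbd : IsBounded (openPolytope ν b)) {ρ : ℝ} (hρ : 0 ≤ ρ) {y : EuclideanSpace ℝ (Fin m)}
    (hy : y ∉ frontier (f.pr '' openPolytope ν b)) :
    crossingSum ν b u (fun _ => ENNReal.ofReal (ρ ^ 2)) (f.ι y) +
      2 * ∫⁻ t : ℝ, (openPolytope ν b).indicator (fun x => ENNReal.ofReal |inner ℝ u x|)
        (f.ι y + t • u) ≤
    crossingSum ν b u (fun x => ENNReal.ofReal (‖x‖ ^ 2)) (f.ι y) +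
      2 * ∫⁻ t : ℝ, (ball (0 : E) ρ).indicator (fun x => ENNReal.ofReal |inner ℝ u x|)
        (f.ι y + t • u) := by
  by_cases hcl : y ∈ closure (f.pr '' openPolytope ν b)
  · have hin : y ∈ f.pr '' openPolytope ν b := by
      by_contra h
      exact hy ⟨hcl, fun h' => h (interior_subset h')⟩
    obtain ⟨p, hp, rfl⟩ := hin
    obtain ⟨s, t, hst, hmem, hsum⟩ := exists_crossingSum_eq ν b hbd (x := f.ι (f.pr p)) hu
      ⟨inner ℝ u p, by rwa [f.decomp]⟩
    have h : ∀ r : ℝ, (openPolytope ν b).indicator (fun x => ENNReal.ofReal |inner ℝ u x|)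
        (f.ι (f.pr p) + r • u) = (Ioo s t).indicator (fun t => ENNReal.ofReal |t|) r := by
      intro r
      simp only [indicator, hmem, f.inner_add_smul hu]
    rw [lintegral_line_ball f hu hρ, hsum, hsum]
    simp_rw [h]
    rw [lintegral_indicator measurableSet_Ioo, lintegral_Ioo_abs hst.le,
      f.norm_sq_add_smul hu, f.norm_sq_add_smul hu]
    set Y := ‖f.pr p‖
    have e1 : (2 : ENNReal) * ENNReal.ofReal ((t * |t| - s * |s|) / 2) ≤
        ENNReal.ofReal (s ^ 2 + t ^ 2) := by
      rw [← ENNReal.ofReal_ofNat 2, ← ENNReal.ofReal_mul zero_le_two]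
      refine ENNReal.ofReal_le_ofReal ?_
      have h1 : t * |t| ≤ t ^ 2 := by
        rw [← sq_abs t, sq]
        exact mul_le_mul_of_nonneg_right (le_abs_self t) (abs_nonneg t)
      have h2 : -(s * |s|) ≤ s ^ 2 := by
        rw [← sq_abs s, sq, ← neg_mul]
        exact mul_le_mul_of_nonneg_right (neg_le_abs s) (abs_nonneg s)
      linarith
    have e2 : ENNReal.ofReal (ρ ^ 2) + ENNReal.ofReal (ρ ^ 2) + ENNReal.ofReal (s ^ 2 + t ^ 2) =
        ENNReal.ofReal (2 * ρ ^ 2 + s ^ 2 + t ^ 2) := by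
      rw [← ENNReal.ofReal_add (by positivity) (by positivity),
        ← ENNReal.ofReal_add (by positivity) (by positivity)]
      ring_nf
    have e3 : ENNReal.ofReal (2 * ρ ^ 2 + s ^ 2 + t ^ 2) ≤
        ENNReal.ofReal ((Y ^ 2 + s ^ 2) + (Y ^ 2 + t ^ 2)) +
          ENNReal.ofReal (2 * (ρ ^ 2 - Y ^ 2)) := by
      refine (ENNReal.ofReal_le_ofReal ?_).trans ENNReal.ofReal_add_le
      linarith
    calc _ ≤ _ := add_le_add_right e1 _
      _ ≤ _ := e2.trans_le e3
      _ = _ := by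
        rw [ENNReal.ofReal_add (by positivity) (by positivity), ENNReal.ofReal_mul zero_le_two,
          ENNReal.ofReal_ofNat]
  · have h : ∀ r : ℝ, (openPolytope ν b).indicator (fun x => ENNReal.ofReal |inner ℝ u x|)
        (f.ι y + r • u) = 0 := by
      refine fun r => indicator_of_notMem (fun hmem => hcl (subset_closure ?_)) _
      have := mem_image_of_mem f.pr hmem
      rwa [f.pr_add_smul hu] at this
    simp [h, crossingSum_eq_zero f hu hcl]

variable [FiniteDimensional ℝ E] [MeasurableSpace E] [BorelSpace E]

theorem sum_mul_setLIntegral_facet (hE : finrank ℝ E = m + 1) (hν : ∀ i, ‖ν i‖ = 1)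
    (f : HyperplaneFrame m u) (hu : ‖u‖ = 1) {c : ENNReal}
    (hc : (μH[m] : Measure (EuclideanSpace ℝ (Fin m))) = c • volume) {G : E → ENNReal}
    (hG : Measurable G) :
    ∑ i, ENNReal.ofReal |inner ℝ (ν i) u| * ∫⁻ x in polytopeFacet ν b i, G x ∂μH[m] =
      c * ∫⁻ y, crossingSum ν b u G (f.ι y) := by
  have hmeas : ∀ i, Measurable fun y : EuclideanSpace ℝ (Fin m) =>
      if inner ℝ (ν i) u = (0 : ℝ) then 0 else (polytopeFacet ν b i).indicator G
        (f.ι y + ((b i - inner ℝ (ν i) (f.ι y)) / inner ℝ (ν i) u) • u) := by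
    intro i
    split_ifs
    · exact measurable_const
    · refine (hG.indicator (measurableSet_polytopeFacet ν b i)).comp
        (Continuous.measurable ?_)
      have := f.ι.continuous
      fun_prop
  simp only [crossingSum]
  rw [lintegral_finsetSum _ fun i _ => hmeas i, Finset.mul_sum]
  refine Finset.sum_congr rfl fun i _ => ?_
  by_cases h0 : inner ℝ (ν i) u = (0 : ℝ)
  · simp [h0]
  obtain ⟨f'⟩ := HyperplaneFrame.nonempty hE (hν i)
  rw [f'.setLIntegral_hausdorffMeasure hc (measurableSet_polytopeFacet ν b i)
    (fun x hx => hx.1) hG, mul_left_comm, HyperplaneFrame.lintegral_projection hE f f' hu (hν i) h0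
    _ (hG.indicator (measurableSet_polytopeFacet ν b i))]
  simp only [h0, if_false]

theorem directional_inequality_of_norm_eq_one (hE : finrank ℝ E = m + 1) (hν : ∀ i, ‖ν i‖ = 1)
    (hu : ‖u‖ = 1) {c : ENNReal}
    (hc : (μH[m] : Measure (EuclideanSpace ℝ (Fin m))) = c • volume)
    (hbd : IsBounded (openPolytope ν b)) {ρ : ℝ} (hρ : 0 ≤ ρ) :
    ∑ i, ENNReal.ofReal |inner ℝ (ν i) u| *
        ∫⁻ _ in polytopeFacet ν b i, ENNReal.ofReal (ρ ^ 2) ∂μH[m] +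
      2 * c * ∫⁻ x in openPolytope ν b, ENNReal.ofReal |inner ℝ u x| ≤
    ∑ i, ENNReal.ofReal |inner ℝ (ν i) u| *
        ∫⁻ x in polytopeFacet ν b i, ENNReal.ofReal (‖x‖ ^ 2) ∂μH[m] +
      2 * c * ∫⁻ x in ball (0 : E) ρ, ENNReal.ofReal |inner ℝ u x| := by
  obtain ⟨f⟩ := HyperplaneFrame.nonempty hE hu
  have hg : Measurable fun x : E => ENNReal.ofReal |inner ℝ u x| := by fun_prop
  have hline : ∀ S : Set E, MeasurableSet S →
      Measurable (fun y : EuclideanSpace ℝ (Fin m) => 2 * ∫⁻ t : ℝ,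
        S.indicator (fun x => ENNReal.ofReal |inner ℝ u x|) (f.ι y + t • u)) ∧
      2 * c * ∫⁻ x in S, ENNReal.ofReal |inner ℝ u x| =
      c * ∫⁻ y, 2 * ∫⁻ t : ℝ,
        S.indicator (fun x => ENNReal.ofReal |inner ℝ u x|) (f.ι y + t • u) := by
    intro S hS
    have h1 : Measurable fun y : EuclideanSpace ℝ (Fin m) => ∫⁻ t : ℝ,
        S.indicator (fun x => ENNReal.ofReal |inner ℝ u x|) (f.ι y + t • u) := by
      have : Measurable fun q : EuclideanSpace ℝ (Fin m) × ℝ => S.indicator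
          (fun x => ENNReal.ofReal |inner ℝ u x|) (f.ι q.1 + q.2 • u) := by
        refine (hg.indicator hS).comp (Continuous.measurable ?_)
        have := f.ι.continuous
        fun_prop
      exact this.lintegral_prod_right'
    refine ⟨h1.const_mul 2, ?_⟩
    rw [← lintegral_indicator hS, f.lintegral_eq hE hu (hg.indicator hS),
      lintegral_const_mul _ h1]
    ring
  have hB := hline (ball 0 ρ) measurableSet_ball
  have hP := hline (openPolytope ν b) (isOpen_openPolytope ν b).measurableSet
  rw [sum_mul_setLIntegral_facet hE hν f hu hc measurable_const,
    sum_mul_setLIntegral_facet hE hν f hu hc (by fun_prop), hB.2, hP.2, ← mul_add, ← mul_add,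
    ← lintegral_add_right _ hB.1, ← lintegral_add_right _ hP.1]
  gcongr 1
  refine lintegral_mono_ae ?_
  have hfr : volume (frontier (f.pr '' openPolytope ν b)) = 0 :=
    Convex.addHaar_frontier volume ((convex_openPolytope ν b).is_linear_image f.pr.isLinear)
  filter_upwards [measure_eq_zero_iff_ae_notMem.1 hfr] with y hy
  exact crossingSum_line_inequality f hu hbd hρ hy

theorem directional_inequality (hE : finrank ℝ E = m + 1) (hν : ∀ i, ‖ν i‖ = 1) (u : E)
    {c : ENNReal} (hc : (μH[m] : Measure (EuclideanSpace ℝ (Fin m))) = c • volume)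
    (hbd : IsBounded (openPolytope ν b)) {ρ : ℝ} (hρ : 0 ≤ ρ) :
    ∑ i, ENNReal.ofReal |inner ℝ (ν i) u| *
        ∫⁻ _ in polytopeFacet ν b i, ENNReal.ofReal (ρ ^ 2) ∂μH[m] +
      2 * c * ∫⁻ x in openPolytope ν b, ENNReal.ofReal |inner ℝ u x| ≤
    ∑ i, ENNReal.ofReal |inner ℝ (ν i) u| *
        ∫⁻ x in polytopeFacet ν b i, ENNReal.ofReal (‖x‖ ^ 2) ∂μH[m] +
      2 * c * ∫⁻ x in ball (0 : E) ρ, ENNReal.ofReal |inner ℝ u x| := by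
  by_cases hu : u = 0
  · simp [hu]
  set v : E := ‖u‖⁻¹ • u with hv
  have hv1 : ‖v‖ = 1 := by simp [hv, norm_smul, hu]
  have hu' : ‖u‖ • v = u := by rw [hv, smul_inv_smul₀ (norm_ne_zero_iff.2 hu)]
  have hl : ∀ w : E, ENNReal.ofReal |inner ℝ w u| =
      ENNReal.ofReal ‖u‖ * ENNReal.ofReal |inner ℝ w v| := by
    intro w
    rw [← ENNReal.ofReal_mul (norm_nonneg u), ← abs_norm u, ← abs_mul,
      ← real_inner_smul_right, hu']
  have hr : ∀ w : E, ENNReal.ofReal |inner ℝ u w| =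
      ENNReal.ofReal ‖u‖ * ENNReal.ofReal |inner ℝ v w| := by
    intro w
    rw [real_inner_comm, hl, real_inner_comm]
  have hm : Measurable fun x : E => ENNReal.ofReal |inner ℝ v x| := by fun_prop
  have key := mul_le_mul_right (directional_inequality_of_norm_eq_one hE hν hv1 hc hbd hρ)
    (ENNReal.ofReal ‖u‖)
  simp_rw [hl, hr, lintegral_const_mul _ hm, mul_assoc (ENNReal.ofReal ‖u‖), ← Finset.mul_sum]
  rw [mul_left_comm (2 * c), mul_left_comm (2 * c), ← mul_add, ← mul_add]
  exact key

end Direction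

section PolytopeInequality

variable {N : ℕ} {ν : Fin N → E} {b : Fin N → ℝ}

theorem setLIntegral_frontier_openPolytope [MeasurableSpace E]
    [BorelSpace E] (μ : Measure E) (G : E → ENNReal) :
    ∫⁻ x in frontier (openPolytope ν b), G x ∂μ = ∑ i, ∫⁻ x in polytopeFacet ν b i, G x ∂μ := by
  rw [frontier_openPolytope, lintegral_iUnion (measurableSet_polytopeFacet ν b), tsum_fintype]
  intro i j hij
  exact disjoint_left.2 fun x hi hj => hij (polytopeFacet_unique ν b hi hj)

variable [FiniteDimensional ℝ E] [MeasurableSpace E] [BorelSpace E]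

theorem lintegral_ball_norm_le {ρ : ℝ} {P : Set E} (hP : MeasurableSet P)
    (hvol : volume (ball (0 : E) ρ) ≤ volume P) :
    ∫⁻ x in ball (0 : E) ρ, ENNReal.ofReal ‖x‖ ≤ ∫⁻ x in P, ENNReal.ofReal ‖x‖ := by
  set B : Set E := ball 0 ρ
  have hB : MeasurableSet B := measurableSet_ball
  have hfin : volume (B ∩ P) ≠ ⊤ :=
    ((measure_mono inter_subset_left).trans_lt measure_ball_lt_top).ne
  have hdiff : volume (B \ P) ≤ volume (P \ B) := by
    rw [← measure_sdiff_add_inter B hP, ← measure_sdiff_add_inter P hB, inter_comm P B] at hvol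
    exact (ENNReal.add_le_add_iff_right hfin).1 hvol
  rw [← lintegral_inter_add_sdiff _ B hP, ← lintegral_inter_add_sdiff _ P hB, inter_comm P B]
  refine add_le_add_right ?_ _
  calc ∫⁻ x in B \ P, ENNReal.ofReal ‖x‖ ≤ ∫⁻ _ in B \ P, ENNReal.ofReal ρ :=
        setLIntegral_mono measurable_const fun x hx =>
          ENNReal.ofReal_le_ofReal (mem_ball_zero_iff.1 hx.1).le
    _ ≤ ∫⁻ _ in P \ B, ENNReal.ofReal ρ := by
        simp only [setLIntegral_const]
        gcongr
    _ ≤ ∫⁻ x in P \ B, ENNReal.ofReal ‖x‖ := by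
        refine setLIntegral_mono (by fun_prop) fun x hx => ENNReal.ofReal_le_ofReal ?_
        exact not_lt.1 fun h => hx.2 (mem_ball_zero_iff.2 h)

theorem lintegral_ball_norm_ne_top (ρ : ℝ) :
    ∫⁻ x in ball (0 : E) ρ, ENNReal.ofReal ‖x‖ ≠ ⊤ := by
  refine ne_top_of_le_ne_top ?_ (setLIntegral_mono (g := fun _ => ENNReal.ofReal ρ)
    measurable_const fun x hx => ENNReal.ofReal_le_ofReal (mem_ball_zero_iff.1 hx).le)
  rw [setLIntegral_const]
  exact ENNReal.mul_ne_top ENNReal.ofReal_ne_top measure_ball_lt_top.ne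

/-- The isoperimetric inequality for the boundary moment of inertia of a polytope. -/
theorem polytope_boundary_moment_ge (hE : finrank ℝ E = m + 1) (hν : ∀ i, ‖ν i‖ = 1)
    (hbd : IsBounded (openPolytope ν b)) {ρ : ℝ} (hρ : 0 ≤ ρ)
    (hvol : volume (ball (0 : E) ρ) ≤ volume (openPolytope ν b)) :
    ENNReal.ofReal (ρ ^ 2) * μH[m] (frontier (openPolytope ν b)) ≤
      ∫⁻ x in frontier (openPolytope ν b), ENNReal.ofReal (‖x‖ ^ 2) ∂μH[m] := by
  obtain ⟨c, -, hctop, hc⟩ := exists_hausdorffMeasure_eq_smul_volume m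
  obtain ⟨A, hA0, hAtop, hA⟩ := exists_lintegral_ball_abs_inner (E := E) hE
  have hsum : ∀ W : Fin N → ENNReal, ∫⁻ u in ball (0 : E) 1,
      ∑ i, ENNReal.ofReal |inner ℝ (ν i) u| * W i = A * ∑ i, W i := by
    intro W
    have hm : ∀ i, Measurable fun u : E => ENNReal.ofReal |inner ℝ (ν i) u| := fun i => by
      fun_prop
    rw [lintegral_finsetSum _ fun i _ => (hm i).mul_const _, Finset.mul_sum]
    refine Finset.sum_congr rfl fun i _ => ?_
    rw [lintegral_mul_const _ (hm i), hA, hν, ENNReal.ofReal_one, mul_one]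
  have hmeas : Measurable fun q : E × E => ENNReal.ofReal |inner ℝ q.1 q.2| := by fun_prop
  have hvolint : ∀ S : Set E,
      (Measurable fun u : E => 2 * c * ∫⁻ x in S, ENNReal.ofReal |inner ℝ u x|) ∧
      ∫⁻ u in ball (0 : E) 1, 2 * c * ∫⁻ x in S, ENNReal.ofReal |inner ℝ u x| =
        A * (2 * c * ∫⁻ x in S, ENNReal.ofReal ‖x‖) := by
    intro S
    have h1 : Measurable fun u : E => ∫⁻ x in S, ENNReal.ofReal |inner ℝ u x| :=
      hmeas.lintegral_prod_right'
    refine ⟨h1.const_mul _, ?_⟩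
    rw [lintegral_const_mul _ h1, lintegral_lintegral_swap hmeas.aemeasurable]
    simp_rw [fun x u : E => real_inner_comm x u, hA]
    rw [lintegral_const_mul _ (by fun_prop)]
    ring
  have key := setLIntegral_mono' (μ := volume) (s := ball (0 : E) 1) measurableSet_ball
    fun u _ => directional_inequality hE hν u hc hbd hρ
  rw [lintegral_add_right _ (hvolint _).1, lintegral_add_right _ (hvolint _).1, hsum, hsum,
    (hvolint _).2, (hvolint _).2, ← mul_add, ← mul_add,
    ENNReal.mul_le_mul_iff_right hA0 hAtop] at key
  rw [← setLIntegral_const, setLIntegral_frontier_openPolytope,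
    setLIntegral_frontier_openPolytope]
  have hfin : 2 * c * ∫⁻ x in ball (0 : E) ρ, ENNReal.ofReal ‖x‖ ≠ ⊤ :=
    ENNReal.mul_ne_top (ENNReal.mul_ne_top ENNReal.ofNat_ne_top hctop)
      (lintegral_ball_norm_ne_top ρ)
  refine (ENNReal.add_le_add_iff_right hfin).1 (le_trans ?_ key)
  exact add_le_add_right (mul_le_mul_right
    (lintegral_ball_norm_le (isOpen_openPolytope ν b).measurableSet hvol) _) _

theorem hausdorffMeasure_frontier_openPolytope_ne_top (hE : finrank ℝ E = m + 1)
    (hν : ∀ i, ‖ν i‖ = 1) (hbd : IsBounded (openPolytope ν b)) :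
    μH[m] (frontier (openPolytope ν b)) ≠ ⊤ := by
  obtain ⟨c, -, hctop, hc⟩ := exists_hausdorffMeasure_eq_smul_volume m
  rw [← setLIntegral_one, setLIntegral_frontier_openPolytope]
  refine (ENNReal.sum_lt_top.2 fun i _ => ?_).ne
  obtain ⟨f⟩ := HyperplaneFrame.nonempty hE (hν i)
  rw [f.setLIntegral_hausdorffMeasure hc (measurableSet_polytopeFacet ν b i)
    (fun x hx => hx.1) measurable_const]
  refine ENNReal.mul_lt_top hctop.lt_top ?_
  obtain ⟨R, hR⟩ := hbd.closure.subset_closedBall (0 : E)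
  have hle : ∀ z : EuclideanSpace ℝ (Fin m),
      (polytopeFacet ν b i).indicator (fun _ => (1 : ENNReal)) (f.ι z + b i • ν i) ≤
        (closedBall (0 : EuclideanSpace ℝ (Fin m)) R).indicator 1 z := by
    intro z
    by_cases hz : f.ι z + b i • ν i ∈ polytopeFacet ν b i
    · have h1 := mem_closedBall_zero_iff.1 (hR hz.2.1.1)
      have h2 := f.norm_sq_add_smul (hν i) z (b i)
      have h3 : ‖z‖ ≤ R := by
        refine le_trans ((sq_le_sq₀ (norm_nonneg _) (norm_nonneg _)).1 ?_) h1
        rw [h2]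
        exact le_add_of_nonneg_right (sq_nonneg _)
      rw [indicator_of_mem hz, indicator_of_mem (mem_closedBall_zero_iff.2 h3), Pi.one_apply]
    · rw [indicator_of_notMem hz]
      exact zero_le
  refine (lintegral_mono hle).trans_lt ?_
  rw [lintegral_indicator_one measurableSet_closedBall]
  exact measure_closedBall_lt_top

end PolytopeInequality

section Approximation

theorem IsPreconnected.inter_frontier_nonempty {X : Type*} [TopologicalSpace X] {S Ω : Set X}
    (hS : IsPreconnected S) (h1 : (S ∩ Ω).Nonempty) (h2 : (S ∩ Ωᶜ).Nonempty) :
    (S ∩ frontier Ω).Nonempty := by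
  by_contra h
  have hd : ∀ x ∈ S, x ∈ closure Ω → x ∈ interior Ω := fun x hx hcl => by
    by_contra hx'
    exact h ⟨x, hx, hcl, hx'⟩
  obtain ⟨x, hxS, hx⟩ := h1
  obtain ⟨y, hyS, hy⟩ := h2
  obtain ⟨z, -, hz1, hz2⟩ := hS (interior Ω) (closure Ω)ᶜ isOpen_interior
    isClosed_closure.isOpen_compl
    (fun z hz => by
      by_cases hcl : z ∈ closure Ω
      exacts [Or.inl (hd z hz hcl), Or.inr hcl])
    ⟨x, hxS, hd x hxS (subset_closure hx)⟩
    ⟨y, hyS, fun hcl => hy (interior_subset (hd y hyS hcl))⟩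
  exact hz2 (interior_subset_closure hz1)

theorem Convex.subset_of_disjoint_frontier {S Ω : Set E} (hS : Convex ℝ S)
    (hne : (S ∩ Ω).Nonempty) (hd : Disjoint S (frontier Ω)) : S ⊆ Ω := by
  by_contra h
  obtain ⟨x, hxS, hx⟩ := not_subset.1 h
  obtain ⟨y, hy⟩ := hS.isPreconnected.inter_frontier_nonempty hne ⟨x, hxS, hx⟩
  exact disjoint_left.1 hd hy.1 hy.2

/-- A closed convex set inside an open bounded convex set can be separated from its complement by
an open polytope. -/
theorem exists_openPolytope_between [FiniteDimensional ℝ E] {K Ω : Set E} (hΩo : IsOpen Ω)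
    (hΩb : IsBounded Ω) (hKc : Convex ℝ K) (hK : IsClosed K)
    (hKne : K.Nonempty) (hKΩ : K ⊆ Ω) :
    ∃ (N : ℕ) (ν : Fin N → E) (b : Fin N → ℝ), (∀ i, ‖ν i‖ = 1) ∧ K ⊆ openPolytope ν b ∧
      openPolytope ν b ⊆ Ω := by
  have hsep : ∀ x : frontier Ω, ∃ (w : E) (β : ℝ), ‖w‖ = 1 ∧ (∀ a ∈ K, inner ℝ w a < β) ∧
      β < inner ℝ w (x : E) := by
    rintro ⟨x, hx⟩
    have hxK : x ∉ K := fun h => hx.2 (by rw [hΩo.interior_eq]; exact hKΩ h)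
    obtain ⟨f, β, hf, hfx⟩ := geometric_hahn_banach_closed_point hKc hK hxK
    set w : E := (InnerProductSpace.toDual ℝ E).symm f
    have hfw : ∀ y, inner ℝ w y = f y := fun y => InnerProductSpace.toDual_symm_apply
    have hw0 : 0 < ‖w‖ := by
      rw [norm_pos_iff]
      intro h0
      obtain ⟨a, ha⟩ := hKne
      have h1 := (hf a ha).trans hfx
      rw [← hfw, ← hfw, h0, inner_zero_left, inner_zero_left] at h1
      exact lt_irrefl _ h1
    refine ⟨‖w‖⁻¹ • w, ‖w‖⁻¹ * β, by simp [norm_smul, hw0.ne'], fun a ha => ?_, ?_⟩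
    · rw [real_inner_smul_left, hfw]
      exact mul_lt_mul_of_pos_left (hf a ha) (inv_pos.2 hw0)
    · rw [real_inner_smul_left, hfw]
      exact mul_lt_mul_of_pos_left hfx (inv_pos.2 hw0)
  choose w β hw1 hwK hwx using hsep
  have hcomp : IsCompact (frontier Ω) :=
    isCompact_of_isClosed_isBounded isClosed_frontier
      (hΩb.closure.subset frontier_subset_closure)
  obtain ⟨T, hT⟩ := hcomp.elim_finite_subcover (fun x => {y | β x < inner ℝ (w x) y})
    (fun x => isOpen_lt continuous_const (by fun_prop))
    (fun x hx => mem_iUnion.2 ⟨⟨x, hx⟩, hwx ⟨x, hx⟩⟩)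
  refine ⟨T.card, fun i => w (T.equivFin.symm i), fun i => β (T.equivFin.symm i),
    fun i => hw1 _, fun a ha i => hwK _ a ha, ?_⟩
  refine (convex_openPolytope _ _).subset_of_disjoint_frontier ?_ ?_
  · obtain ⟨a, ha⟩ := hKne
    exact ⟨a, fun i => hwK _ a ha, hKΩ ha⟩
  · refine disjoint_left.2 fun y hy hyf => ?_
    obtain ⟨x, hxT, hx⟩ := mem_iUnion₂.1 (hT hyf)
    have := hy (T.equivFin ⟨x, hxT⟩)
    simp only [Equiv.symm_apply_apply] at this
    exact lt_asymm this hx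

end Approximation

section Projection

/-- A map onto the closed set `K` satisfying the variational inequality of the nearest-point
projection. -/
structure IsConvexProjection (K : Set E) (q : E → E) : Prop where
  mem : ∀ x, q x ∈ K
  inner_le : ∀ x, ∀ w ∈ K, inner ℝ (x - q x) (w - q x) ≤ 0

theorem exists_isConvexProjection [FiniteDimensional ℝ E] {K : Set E} (hc : Convex ℝ K)
    (hK : IsClosed K) (hne : K.Nonempty) : ∃ q : E → E, IsConvexProjection K q := by
  have h : ∀ x, ∃ p ∈ K, ∀ w ∈ K, inner ℝ (x - p) (w - p) ≤ 0 := by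
    intro x
    obtain ⟨p, hp, h⟩ := exists_norm_eq_iInf_of_complete_convex hne hK.isComplete hc x
    exact ⟨p, hp, (norm_eq_iInf_iff_real_inner_le_zero hc hp).1 h⟩
  choose q h1 h2 using h
  exact ⟨q, h1, h2⟩

namespace IsConvexProjection

variable {K : Set E} {q : E → E}

theorem norm_sub_le_of_mem (hq : IsConvexProjection K q) (x : E) {w : E} (hw : w ∈ K) :
    ‖x - q x‖ ≤ ‖x - w‖ := by
  rw [← sq_le_sq₀ (norm_nonneg _) (norm_nonneg _)]
  have h1 := norm_sub_sq_real (x - q x) (w - q x)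
  have h2 := hq.inner_le x w hw
  rw [sub_sub_sub_cancel_right] at h1
  nlinarith [sq_nonneg ‖w - q x‖]

theorem lipschitzWith (hq : IsConvexProjection K q) : LipschitzWith 1 q := by
  refine LipschitzWith.of_dist_le_mul fun x y => ?_
  rw [NNReal.coe_one, one_mul, dist_eq_norm, dist_eq_norm]
  have h1 := hq.inner_le x _ (hq.mem y)
  have h2 := hq.inner_le y _ (hq.mem x)
  have h3 : ‖q x - q y‖ ^ 2 ≤ inner ℝ (x - y) (q x - q y) := by
    rw [← real_inner_self_eq_norm_sq]
    have : inner ℝ (x - y) (q x - q y) = inner ℝ (q x - q y) (q x - q y) -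
        inner ℝ (x - q x) (q y - q x) - inner ℝ (y - q y) (q x - q y) := by
      simp only [inner_sub_left, inner_sub_right]
      ring
    linarith
  have h4 := h3.trans (real_inner_le_norm _ _)
  by_contra! hlt
  nlinarith [norm_nonneg (x - y), norm_nonneg (q x - q y)]

theorem eq_of_inner_le (hq : IsConvexProjection K q) {x p : E} (hp : p ∈ K)
    (h : ∀ w ∈ K, inner ℝ (x - p) (w - p) ≤ 0) : q x = p := by
  have h1 := hq.inner_le x p hp
  have h2 := h _ (hq.mem x)
  rw [← sub_eq_zero, ← inner_self_eq_zero (𝕜 := ℝ)]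
  refine le_antisymm ?_ real_inner_self_nonneg
  have : inner ℝ (q x - p) (q x - p) = inner ℝ (x - q x) (p - q x) +
      inner ℝ (x - p) (q x - p) := by
    simp only [inner_sub_left, inner_sub_right]
    ring
  linarith

end IsConvexProjection

theorem IsConvexProjection.frontier_subset_image [FiniteDimensional ℝ E] {K L : Set E}
    {q : E → E} (hq : IsConvexProjection (closure K) q) (hKo : IsOpen K) (hKc : Convex ℝ K)
    (hKL : K ⊆ L) (hL : IsBounded L) : frontier K ⊆ q '' frontier L := by
  intro x hx
  have hxK : x ∉ K := fun h => hx.2 (by rwa [hKo.interior_eq])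
  obtain ⟨f, hf⟩ := geometric_hahn_banach_open_point hKc hKo hxK
  set w : E := (InnerProductSpace.toDual ℝ E).symm f
  have hfw : ∀ y, inner ℝ w y = f y := fun y => InnerProductSpace.toDual_symm_apply
  have hle : ∀ a ∈ closure K, inner ℝ w (a - x) ≤ 0 := by
    have : closure K ⊆ {a | inner ℝ w (a - x) ≤ 0} := by
      refine closure_minimal (fun a ha => ?_) (isClosed_le (by fun_prop) continuous_const)
      have := hf a ha
      rw [mem_ofPred_eq, hfw, map_sub]
      linarith
    exact this
  have hw0 : 0 < ‖w‖ := by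
    rw [norm_pos_iff]
    intro h0
    obtain ⟨a, ha⟩ := closure_nonempty_iff.1 ⟨x, hx.1⟩
    have h1 := hf a ha
    rw [← hfw, ← hfw, h0, inner_zero_left, inner_zero_left] at h1
    exact lt_irrefl _ h1
  obtain ⟨s, hs, hz⟩ : ∃ s : ℝ, 0 ≤ s ∧ x + s • w ∈ frontier L := by
    by_cases hxL : x ∈ L
    · let T : Set E := (fun s : ℝ => x + s • w) '' Ici 0
      have hT : IsPreconnected T :=
        isPreconnected_Ici.image _ (Continuous.continuousOn (by fun_prop))
      have hleave : (T ∩ Lᶜ).Nonempty := by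
        by_contra hcon
        obtain ⟨R, hR⟩ := hL.subset_closedBall x
        have h1 : x + ((|R| + 1) / ‖w‖) • w ∈ L := by
          by_contra h
          exact hcon ⟨_, ⟨_, mem_Ici.2 (by positivity), rfl⟩, h⟩
        have h2 := hR h1
        rw [mem_closedBall, dist_eq_norm, add_sub_cancel_left, norm_smul, norm_div, norm_norm,
          div_mul_cancel₀ _ hw0.ne', norm_of_nonneg (by positivity)] at h2
        linarith [le_abs_self R]
      obtain ⟨z, ⟨s, hs, rfl⟩, hz⟩ := hT.inter_frontier_nonempty
        ⟨x, ⟨0, mem_Ici.2 le_rfl, by simp⟩, hxL⟩ hleave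
      exact ⟨s, hs, hz⟩
    · refine ⟨0, le_rfl, ?_⟩
      rw [zero_smul, add_zero]
      exact ⟨closure_mono hKL hx.1, fun h => hxL (interior_subset h)⟩
  refine ⟨_, hz, hq.eq_of_inner_le hx.1 fun a ha => ?_⟩
  rw [add_sub_cancel_left, real_inner_smul_left]
  exact mul_nonpos_of_nonneg_of_nonpos hs (hle a ha)

theorem IsConvexProjection.setLIntegral_frontier_le [FiniteDimensional ℝ E] [MeasurableSpace E]
    [BorelSpace E] {K L : Set E} {q : E → E} (hq : IsConvexProjection (closure K) q)
    (hKo : IsOpen K) (hKc : Convex ℝ K) (hKL : K ⊆ L) (hL : IsBounded L) {g : E → ENNReal}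
    (hg : Measurable g) {d : ℝ} (hd : 0 ≤ d) :
    ∫⁻ x in frontier K, g x ∂μH[d] ≤ ∫⁻ x in frontier L, g (q x) ∂μH[d] := by
  have hqm : Measurable q := hq.lipschitzWith.continuous.measurable
  rw [← lintegral_map hg hqm]
  refine lintegral_mono' (Measure.le_iff.2 fun S hS => ?_) le_rfl
  rw [Measure.map_apply hqm hS, Measure.restrict_apply hS, Measure.restrict_apply (hqm hS)]
  have hsub : S ∩ frontier K ⊆ q '' (q ⁻¹' S ∩ frontier L) := by
    rintro x ⟨hxS, hx⟩
    obtain ⟨z, hz, rfl⟩ := hq.frontier_subset_image hKo hKc hKL hL hx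
    exact ⟨z, ⟨hxS, hz⟩, rfl⟩
  refine (measure_mono hsub).trans ((hq.lipschitzWith.hausdorffMeasure_image_le hd _).trans ?_)
  simp

/-- Monotonicity of the perimeter of convex sets under inclusion. -/
theorem hausdorffMeasure_frontier_mono [FiniteDimensional ℝ E] [MeasurableSpace E]
    [BorelSpace E] {K L : Set E} (hKo : IsOpen K) (hKc : Convex ℝ K) (hKne : K.Nonempty)
    (hKL : K ⊆ L) (hL : IsBounded L) {d : ℝ} (hd : 0 ≤ d) :
    μH[d] (frontier K) ≤ μH[d] (frontier L) := by
  obtain ⟨q, hq⟩ := exists_isConvexProjection hKc.closure isClosed_closure hKne.closure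
  simpa using hq.setLIntegral_frontier_le hKo hKc hKL hL (g := fun _ => 1) measurable_const hd

end Projection

section BoundaryMoment

open AffineMap

theorem homothety_inv_homothety (x : E) {t : ℝ} (ht : t ≠ 0) (y : E) :
    homothety x t⁻¹ (homothety x t y) = y := by
  rw [← homothety_mul_apply, inv_mul_cancel₀ ht, homothety_one, id_apply]

theorem frontier_image_homothety (x : E) {t : ℝ} (ht : t ≠ 0) (S : Set E) :
    frontier (homothety x t '' S) = homothety x t '' frontier S := by
  let e : E ≃ₜ E :=
    { toFun := homothety x t
      invFun := homothety x t⁻¹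
      left_inv := homothety_inv_homothety x ht
      right_inv := fun y => by
        simpa only [inv_inv] using homothety_inv_homothety x (inv_ne_zero ht) y
      continuous_toFun := homothety_continuous x t
      continuous_invFun := homothety_continuous x t⁻¹ }
  exact (e.image_frontier S).symm

/-- A bounded open convex set contains a polytope which contains a given smaller homothetic copy
of its closure. -/
theorem exists_openPolytope_homothety [FiniteDimensional ℝ E] {Ω : Set E} (hΩo : IsOpen Ω)
    (hΩc : Convex ℝ Ω) (hΩb : IsBounded Ω) {x₀ : E} (hx₀ : x₀ ∈ Ω) {l : ℝ} (hl0 : 0 < l)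
    (hl1 : l < 1) :
    ∃ (N : ℕ) (ν : Fin N → E) (b : Fin N → ℝ), (∀ i, ‖ν i‖ = 1) ∧
      homothety x₀ l '' closure Ω ⊆ openPolytope ν b ∧ openPolytope ν b ⊆ Ω := by
  have hcomp : IsCompact (closure Ω) :=
    isCompact_of_isClosed_isBounded isClosed_closure hΩb.closure
  refine exists_openPolytope_between hΩo hΩb
    (hΩc.closure.affine_image _)
    (hcomp.image (homothety_continuous x₀ l)).isClosed ⟨_, x₀, subset_closure hx₀, rfl⟩ ?_
  rintro _ ⟨y, hy, rfl⟩
  obtain ⟨z, hz, rfl⟩ := hΩc.closure_subset_image_homothety_interior_of_one_lt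
    (x := x₀) (by rwa [hΩo.interior_eq]) l⁻¹ ((one_lt_inv₀ hl0).2 hl1) hy
  have := homothety_inv_homothety x₀ (inv_ne_zero hl0.ne') z
  rw [inv_inv] at this
  rw [this]
  exact interior_subset hz

variable [FiniteDimensional ℝ E] [MeasurableSpace E] [BorelSpace E] {Ω : Set E}

theorem hausdorffMeasure_frontier_le_of_homothety_subset (hΩo : IsOpen Ω) (hΩc : Convex ℝ Ω)
    {x₀ : E} (hx₀ : x₀ ∈ Ω) {l : ℝ} (hl0 : 0 < l) {P : Set E} (hP : IsBounded P)
    (hsub : homothety x₀ l '' closure Ω ⊆ P) :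
    ENNReal.ofReal (l ^ m) * μH[m] (frontier Ω) ≤ μH[m] (frontier P) := by
  have hsub' : Ω ⊆ homothety x₀ l⁻¹ '' P := fun x hx =>
    ⟨_, hsub ⟨x, subset_closure hx, rfl⟩, homothety_inv_homothety x₀ hl0.ne' x⟩
  have hb : IsBounded (homothety x₀ l⁻¹ '' P) := by
    have hcomp : IsCompact (closure P) :=
      isCompact_of_isClosed_isBounded isClosed_closure hP.closure
    exact (hcomp.image (homothety_continuous x₀ l⁻¹)).isBounded.subset
      (image_mono subset_closure)
  have h := hausdorffMeasure_frontier_mono hΩo hΩc ⟨x₀, hx₀⟩ hsub' hb (Nat.cast_nonneg (α := ℝ) m)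
  rw [frontier_image_homothety x₀ (inv_ne_zero hl0.ne'),
    hausdorffMeasure_homothety_image (Nat.cast_nonneg m) x₀ (inv_ne_zero hl0.ne'),
    NNReal.rpow_natCast, ENNReal.smul_def, smul_eq_mul] at h
  refine (mul_le_mul_right h _).trans_eq ?_
  rw [← mul_assoc, ENNReal.coe_pow, nnnorm_inv, ENNReal.coe_inv (by simpa using hl0.ne'),
    ← enorm_eq_nnnorm, enorm_of_nonneg hl0.le, ENNReal.ofReal_pow hl0.le, ← mul_pow,
    ENNReal.mul_inv_cancel (by simpa using hl0) ENNReal.ofReal_ne_top, one_pow, one_mul]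

theorem hausdorffMeasure_frontier_ne_top (hE : finrank ℝ E = m + 1) (hΩo : IsOpen Ω)
    (hΩc : Convex ℝ Ω) (hΩb : IsBounded Ω) (hne : Ω.Nonempty) : μH[m] (frontier Ω) ≠ ⊤ := by
  obtain ⟨x₀, hx₀⟩ := hne
  obtain ⟨N, ν, b, hν, h1, h2⟩ := exists_openPolytope_homothety hΩo hΩc hΩb hx₀
    (l := 1 / 2) (by norm_num) (by norm_num)
  have h := hausdorffMeasure_frontier_le_of_homothety_subset (m := m) hΩo hΩc hx₀ (by norm_num)
    (hΩb.subset h2) h1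
  intro htop
  rw [htop, ENNReal.mul_top (by simp), top_le_iff] at h
  exact hausdorffMeasure_frontier_openPolytope_ne_top hE hν (hΩb.subset h2) h

theorem boundary_moment_ge_of_lt_one (hE : finrank ℝ E = m + 1) (hΩo : IsOpen Ω)
    (hΩc : Convex ℝ Ω) (hΩb : IsBounded Ω) {x₀ : E} (hx₀ : x₀ ∈ Ω) {R : ℝ}
    (hR : closure Ω ⊆ closedBall 0 R) {r : ℝ} (hr : 0 ≤ r)
    (hvol : volume (ball (0 : E) r) ≤ volume Ω) {l : ℝ} (hl0 : 0 < l) (hl1 : l < 1) :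
    ENNReal.ofReal ((l * r) ^ 2) * (ENNReal.ofReal (l ^ m) * μH[m] (frontier Ω)) ≤
      ∫⁻ x in frontier Ω, ENNReal.ofReal ((‖x‖ + (1 - l) * (2 * R)) ^ 2) ∂μH[m] := by
  obtain ⟨N, ν, b, hν, h1, h2⟩ := exists_openPolytope_homothety hΩo hΩc hΩb hx₀ hl0 hl1
  set P := openPolytope ν b
  have hPb : IsBounded P := hΩb.subset h2
  have hPc : Convex ℝ P := convex_openPolytope ν b
  have hPne : P.Nonempty := ⟨_, h1 ⟨x₀, subset_closure hx₀, rfl⟩⟩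
  have : Nontrivial E := Module.nontrivial_of_finrank_pos (R := ℝ) (by omega)
  have hvolP : volume (ball (0 : E) (l * r)) ≤ volume P := by
    rw [Measure.addHaar_ball_mul _ _ hl0.le]
    refine le_trans ?_ (measure_mono ((image_mono subset_closure).trans h1))
    rw [Measure.addHaar_image_homothety, abs_of_pos (by positivity)]
    exact mul_le_mul_right hvol _
  obtain ⟨q, hq⟩ := exists_isConvexProjection hPc.closure isClosed_closure hPne.closure
  calc _ ≤ ENNReal.ofReal ((l * r) ^ 2) * μH[m] (frontier P) :=
        mul_le_mul_right
          (hausdorffMeasure_frontier_le_of_homothety_subset hΩo hΩc hx₀ hl0 hPb h1) _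
    _ ≤ ∫⁻ x in frontier P, ENNReal.ofReal (‖x‖ ^ 2) ∂μH[m] :=
        polytope_boundary_moment_ge hE hν hPb (by positivity) hvolP
    _ ≤ ∫⁻ x in frontier Ω, ENNReal.ofReal (‖q x‖ ^ 2) ∂μH[m] :=
        hq.setLIntegral_frontier_le (isOpen_openPolytope ν b) hPc h2 hΩb
          (g := fun x => ENNReal.ofReal (‖x‖ ^ 2)) (by fun_prop) (Nat.cast_nonneg m)
    _ ≤ _ := by
      refine setLIntegral_mono (by fun_prop) fun x hx => ENNReal.ofReal_le_ofReal ?_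
      refine pow_le_pow_left₀ (norm_nonneg _) ?_ 2
      have h3 := hq.norm_sub_le_of_mem x (subset_closure (h1 ⟨x, hx.1, rfl⟩))
      have h4 : x - homothety x₀ l x = (1 - l) • (x - x₀) := by
        rw [homothety_apply, vsub_eq_sub, vadd_eq_add]
        module
      rw [h4, norm_smul, norm_of_nonneg (by linarith)] at h3
      have h5 := mem_closedBall_zero_iff.1 (hR hx.1)
      have h6 := mem_closedBall_zero_iff.1 (hR (subset_closure hx₀))
      have h7 : ‖q x‖ ≤ ‖x‖ + ‖x - q x‖ := by
        have := norm_sub_le x (x - q x)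
        rwa [sub_sub_cancel] at this
      have h8 : (1 - l) * ‖x - x₀‖ ≤ (1 - l) * (2 * R) :=
        mul_le_mul_of_nonneg_left (by linarith [norm_sub_le x x₀]) (by linarith)
      linarith

/-- The boundary moment of inertia of a bounded open convex set is at least its perimeter times
the square of the radius of any ball of smaller volume. -/
theorem boundary_moment_ge (hE : finrank ℝ E = m + 1) (hΩo : IsOpen Ω)
    (hΩc : Convex ℝ Ω) (hΩb : IsBounded Ω) {r : ℝ} (hr : 0 ≤ r)
    (hvol : volume (ball (0 : E) r) ≤ volume Ω) :
    ENNReal.ofReal (r ^ 2) * μH[m] (frontier Ω) ≤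
      ∫⁻ x in frontier Ω, ENNReal.ofReal (‖x‖ ^ 2) ∂μH[m] := by
  rcases Ω.eq_empty_or_nonempty with rfl | ⟨x₀, hx₀⟩
  · simp
  have hfin := hausdorffMeasure_frontier_ne_top hE hΩo hΩc hΩb ⟨x₀, hx₀⟩
  obtain ⟨R, hR⟩ := hΩb.closure.subset_closedBall (0 : E)
  have hR0 : 0 ≤ R :=
    (norm_nonneg x₀).trans (mem_closedBall_zero_iff.1 (hR (subset_closure hx₀)))
  have hbound : ∀ l : ℝ, l ∈ Ioo (0 : ℝ) 1 →
      ENNReal.ofReal ((l * r) ^ 2 * l ^ m) * μH[m] (frontier Ω) ≤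
      ∫⁻ x in frontier Ω, ENNReal.ofReal (‖x‖ ^ 2) ∂μH[m] +
        ENNReal.ofReal (2 * R * ((1 - l) * (2 * R)) + ((1 - l) * (2 * R)) ^ 2) *
          μH[m] (frontier Ω) := by
    intro l hl
    have h := boundary_moment_ge_of_lt_one hE hΩo hΩc hΩb hx₀ hR hr hvol hl.1 hl.2
    rw [← mul_assoc, ← ENNReal.ofReal_mul (sq_nonneg _)] at h
    refine h.trans ?_
    rw [← setLIntegral_const, ← lintegral_add_right _ measurable_const]
    refine setLIntegral_mono (by fun_prop) fun x hx => ?_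
    have hδ : 0 ≤ (1 - l) * (2 * R) := mul_nonneg (by linarith [hl.2]) (by linarith)
    have hxR := mem_closedBall_zero_iff.1 (hR hx.1)
    rw [← ENNReal.ofReal_add (sq_nonneg _) (by positivity)]
    refine ENNReal.ofReal_le_ofReal ?_
    nlinarith [mul_le_mul_of_nonneg_right hxR hδ]
  have hmem : Ioo (0 : ℝ) 1 ∈ nhdsWithin (1 : ℝ) (Iio 1) := Ioo_mem_nhdsLT one_pos
  have hlim : ∀ φ : ℝ → ℝ, Continuous φ →
      Filter.Tendsto (fun l => ENNReal.ofReal (φ l) * μH[m] (frontier Ω))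
        (nhdsWithin 1 (Iio 1)) (nhds (ENNReal.ofReal (φ 1) * μH[m] (frontier Ω))) := by
    intro φ hφ
    exact ENNReal.Tendsto.mul_const
      (((ENNReal.continuous_ofReal.comp hφ).tendsto 1).mono_left nhdsWithin_le_nhds)
      (Or.inr hfin)
  have h := le_of_tendsto_of_tendsto (hlim (fun l => (l * r) ^ 2 * l ^ m) (by fun_prop))
    ((hlim (fun l => 2 * R * ((1 - l) * (2 * R)) + ((1 - l) * (2 * R)) ^ 2)
      (by fun_prop)).const_add _) (Filter.mem_of_superset hmem hbound)
  simpa using h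

theorem boundary_moment_sub_ge (hE : finrank ℝ E = m + 1) (hΩo : IsOpen Ω)
    (hΩc : Convex ℝ Ω) (hΩb : IsBounded Ω) {r : ℝ} (hr : 0 ≤ r)
    (hvol : volume (ball (0 : E) r) ≤ volume Ω) (a : E) :
    ENNReal.ofReal (r ^ 2) * μH[m] (frontier Ω) ≤
      ∫⁻ x in frontier Ω, ENNReal.ofReal (‖x - a‖ ^ 2) ∂μH[m] := by
  let e : E ≃ᵢ E := IsometryEquiv.subRight a
  have hfr : frontier (e '' Ω) = e '' frontier Ω := (e.toHomeomorph.image_frontier Ω).symm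
  have himage : e '' Ω = (fun x => x + a) ⁻¹' Ω := e.toEquiv.image_eq_preimage_symm Ω
  have hvol' : volume (e '' Ω) = volume Ω := by
    rw [himage]
    exact measure_preimage_add_right volume a Ω
  have h := boundary_moment_ge (Ω := e '' Ω) hE (e.toHomeomorph.isOpenMap Ω hΩo)
    (himage ▸ hΩc.translate_preimage_left a) (e.isometry.lipschitz.isBounded_image hΩb) hr
    (hvol.trans_eq hvol'.symm)
  have hmp := e.measurePreserving_hausdorffMeasure (m : ℝ)
  rw [hfr, e.isometry.hausdorffMeasure_image (Or.inl (Nat.cast_nonneg m)),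
    ← hmp.setLIntegral_comp_emb e.toHomeomorph.measurableEmbedding] at h
  exact h

end BoundaryMoment

section Steklov

variable {n : ℕ}

theorem gradient_coord_sub (i : Fin n) (c : ℝ) (x : EuclideanSpace ℝ (Fin n)) :
    gradient (fun y : EuclideanSpace ℝ (Fin n) => y i - c) x = EuclideanSpace.single i 1 := by
  refine HasGradientAt.gradient (hasGradientAt_iff_hasFDerivAt.2 ?_)
  have h : InnerProductSpace.toDual ℝ (EuclideanSpace ℝ (Fin n)) (EuclideanSpace.single i 1) =
      EuclideanSpace.proj i := by
    ext y
    simp [InnerProductSpace.toDual_apply_apply, EuclideanSpace.inner_single_left]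
  rw [h]
  exact (EuclideanSpace.proj (𝕜 := ℝ) i).hasFDerivAt.sub_const c

theorem steklov_nonneg (Ω : Set (EuclideanSpace ℝ (Fin n))) : 0 ≤ steklov n Ω := by
  refine Real.sInf_nonneg ?_
  rintro r ⟨v, -, -, hv, rfl⟩
  exact div_nonneg (integral_nonneg fun x => sq_nonneg _) hv.le

theorem steklov_mul_le (Ω : Set (EuclideanSpace ℝ (Fin n)))
    {v : EuclideanSpace ℝ (Fin n) → ℝ} (hv : ContDiff ℝ 1 v)
    (hv0 : ∫ x in frontier Ω, v x ∂μH[(n : ℝ) - 1] = 0) :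
    steklov n Ω * ∫ x in frontier Ω, v x ^ 2 ∂μH[(n : ℝ) - 1] ≤
      ∫ x in Ω, ‖gradient v x‖ ^ 2 := by
  have h0 : 0 ≤ ∫ x in frontier Ω, v x ^ 2 ∂μH[(n : ℝ) - 1] :=
    integral_nonneg fun x => sq_nonneg _
  rcases h0.eq_or_lt with h | h
  · rw [← h, mul_zero]
    exact integral_nonneg fun x => sq_nonneg _
  rw [← le_div_iff₀ h]
  refine csInf_le ⟨0, ?_⟩ ⟨v, hv, hv0, h, rfl⟩
  rintro r ⟨w, -, -, hw, rfl⟩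
  exact div_nonneg (integral_nonneg fun x => sq_nonneg _) hw.le

/-- Testing the Steklov quotient with the coordinate functions centred at the boundary centroid. -/
theorem exists_steklov_mul_boundary_moment_le {Ω : Set (EuclideanSpace ℝ (Fin n))}
    (hbd : IsBounded Ω) (hfin : μH[(n : ℝ) - 1] (frontier Ω) ≠ ⊤) :
    ∃ a : EuclideanSpace ℝ (Fin n),
      Integrable (fun x => ‖x - a‖ ^ 2) ((μH[(n : ℝ) - 1]).restrict (frontier Ω)) ∧
      steklov n Ω * ∫ x in frontier Ω, ‖x - a‖ ^ 2 ∂μH[(n : ℝ) - 1] ≤ n * vol n Ω := by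
  set μ : Measure (EuclideanSpace ℝ (Fin n)) := (μH[(n : ℝ) - 1]).restrict (frontier Ω)
  have : IsFiniteMeasure μ := isFiniteMeasure_restrict.2 hfin
  have hcomp : IsCompact (frontier Ω) :=
    isCompact_of_isClosed_isBounded isClosed_frontier
      (hbd.closure.subset frontier_subset_closure)
  have hintg : ∀ g : EuclideanSpace ℝ (Fin n) → ℝ, Continuous g → Integrable g μ := by
    intro g hg
    exact hg.continuousOn.integrableOn_of_subset_isCompact hcomp
      isClosed_frontier.measurableSet subset_rfl hfin
  let a : EuclideanSpace ℝ (Fin n) := WithLp.toLp 2 fun i => ⨍ x, x i ∂μ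
  have hcont : ∀ i : Fin n, Continuous fun x : EuclideanSpace ℝ (Fin n) => x i := fun i =>
    (EuclideanSpace.proj (𝕜 := ℝ) i).continuous
  have hnorm : ∀ x : EuclideanSpace ℝ (Fin n), ‖x - a‖ ^ 2 = ∑ i, (x i - a i) ^ 2 := by
    intro x
    simp [EuclideanSpace.norm_sq_eq]
  refine ⟨a, hintg _ (by fun_prop), ?_⟩
  simp_rw [hnorm]
  rw [integral_finsetSum _ fun i _ => hintg (fun x => (x i - a i) ^ 2)
    (((hcont i).sub continuous_const).pow 2),
    Finset.mul_sum]
  have hterm : ∀ i, steklov n Ω * ∫ x, (x i - a i) ^ 2 ∂μ ≤ vol n Ω := by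
    intro i
    refine (steklov_mul_le Ω (v := fun x => x i - a i) ?_ ?_).trans_eq ?_
    · exact (EuclideanSpace.proj (𝕜 := ℝ) i).contDiff.sub contDiff_const
    · exact integral_sub_average μ fun x => x i
    · simp only [gradient_coord_sub]
      simp [vol, Measure.real]
  calc _ ≤ ∑ _i : Fin n, vol n Ω := Finset.sum_le_sum fun i _ => hterm i
    _ = _ := by simp

end Steklov

/-- `σ(Ω) · P(Ω) / V(Ω)^{(n-2)/n} ≤ n ω_n^{2/n}`, the right-hand side being the
value of this quantity on any ball. -/
theorem steklov_perim_over_vol_bound (n : ℕ) (hn : 2 ≤ n)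
    (Ω : Set (EuclideanSpace ℝ (Fin n)))
    (hbd : IsBounded Ω) (hop : IsOpen Ω) (hconv : Convex ℝ Ω)
    (hint : (interior Ω).Nonempty) :
    steklov n Ω * perim n Ω / vol n Ω ^ (((n : ℝ) - 2) / n) ≤
      (n : ℝ) * unitBallVol n ^ ((2 : ℝ) / n) := by
  obtain ⟨m, rfl⟩ : ∃ m, n = m + 1 := ⟨n - 1, by omega⟩
  have hne : Ω.Nonempty := hint.mono interior_subset
  have hE : finrank ℝ (EuclideanSpace ℝ (Fin (m + 1))) = m + 1 := by simp
  have hd : ((m + 1 : ℕ) : ℝ) - 1 = m := by push_cast; ring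
  have hn0 : ((m + 1 : ℕ) : ℝ) ≠ 0 := by positivity
  have hfin : μH[((m + 1 : ℕ) : ℝ) - 1] (frontier Ω) ≠ ⊤ := by
    rw [hd]
    exact hausdorffMeasure_frontier_ne_top hE hop hconv hbd hne
  obtain ⟨a, hinta, hσ⟩ := exists_steklov_mul_boundary_moment_le hbd hfin
  have hVtop : volume Ω ≠ ⊤ := hbd.measure_lt_top.ne
  have hV : 0 < vol (m + 1) Ω := ENNReal.toReal_pos (hop.measure_pos volume hne).ne' hVtop
  have hω : 0 < unitBallVol (m + 1) :=
    ENNReal.toReal_pos (measure_ball_pos volume _ one_pos).ne' measure_ball_lt_top.ne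
  set V := vol (m + 1) Ω
  set w := unitBallVol (m + 1)
  set r : ℝ := (V / w) ^ ((1 : ℝ) / (m + 1 : ℕ)) with hr
  have hr0 : 0 ≤ r := by positivity
  have hrn : r ^ (m + 1) = V / w := by
    rw [hr, ← rpow_natCast, ← rpow_mul (by positivity), one_div_mul_cancel hn0, rpow_one]
  have hr2 : r ^ 2 = V ^ ((2 : ℝ) / (m + 1 : ℕ)) / w ^ ((2 : ℝ) / (m + 1 : ℕ)) := by
    rw [← div_rpow hV.le hω.le, hr, ← rpow_natCast, ← rpow_mul (by positivity)]
    congr 1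
    push_cast
    ring
  have hball : volume (ball (0 : EuclideanSpace ℝ (Fin (m + 1))) r) ≤ volume Ω := by
    rw [Measure.addHaar_ball _ _ hr0, hE, hrn, ← ENNReal.ofReal_toReal hVtop,
      ← ENNReal.ofReal_toReal (measure_ball_lt_top (μ := volume)
        (x := (0 : EuclideanSpace ℝ (Fin (m + 1)))) (r := 1)).ne,
      ← ENNReal.ofReal_mul (by positivity)]
    refine ENNReal.ofReal_le_ofReal (le_of_eq ?_)
    exact div_mul_cancel₀ V hω.ne'
  have hmom := boundary_moment_sub_ge hE hop hconv hbd hr0 hball a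
  rw [← hd, ← ofReal_integral_eq_lintegral_ofReal hinta
    (Filter.Eventually.of_forall fun x => sq_nonneg _)] at hmom
  have hmom' : r ^ 2 * perim (m + 1) Ω ≤
      ∫ x in frontier Ω, ‖x - a‖ ^ 2 ∂μH[((m + 1 : ℕ) : ℝ) - 1] := by
    have h := ENNReal.toReal_mono ENNReal.ofReal_ne_top hmom
    rwa [ENNReal.toReal_mul, ENNReal.toReal_ofReal (sq_nonneg r),
      ENNReal.toReal_ofReal (integral_nonneg fun x => sq_nonneg _)] at h
  have hfinal := (mul_le_mul_of_nonneg_left hmom' (steklov_nonneg Ω)).trans hσ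
  have hsplit : V ^ ((2 : ℝ) / (m + 1 : ℕ)) *
      V ^ ((((m + 1 : ℕ) : ℝ) - 2) / (m + 1 : ℕ)) = V := by
    rw [← rpow_add hV, ← add_div, add_sub_cancel, div_self hn0, rpow_one]
  have hVα : 0 < V ^ ((2 : ℝ) / (m + 1 : ℕ)) := by positivity
  have hwα : 0 < w ^ ((2 : ℝ) / (m + 1 : ℕ)) := by positivity
  rw [div_le_iff₀ (by positivity)]
  rw [hr2] at hfinal
  refine le_of_mul_le_mul_left ?_ (div_pos hVα hwα)
  generalize V ^ ((2 : ℝ) / (m + 1 : ℕ)) = A at *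
  generalize w ^ ((2 : ℝ) / (m + 1 : ℕ)) = B at *
  generalize V ^ ((((m + 1 : ℕ) : ℝ) - 2) / (m + 1 : ℕ)) = C at *
  calc A / B * (steklov (m + 1) Ω * perim (m + 1) Ω) =
        steklov (m + 1) Ω * (A / B * perim (m + 1) Ω) := by ring
    _ ≤ (m + 1 : ℕ) * V := hfinal
    _ = (m + 1 : ℕ) * (A * C) := by rw [hsplit]
    _ = A / B * ((m + 1 : ℕ) * B * C) := by field_simp
end
end

section
/- Let n ≥ 2 and let Ω ⊆ ℝ^n be a bounded open convex set with nonempty interior whose boundary has barycenter at the origin, i.e. ∫_{∂Ω} x dH^{n-1}(x) = 0 (componentwise). Then σ(Ω) ≤ n V(Ω) / W(Ω). -/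
open MeasureTheory Metric Set Real Bornology

noncomputable section

open scoped NNReal ENNReal Topology

/-- Rescaling by the inverse of a Lipschitz function is Lipschitz on a bounded set on which
that function is bounded below by a positive constant. -/
theorem LipschitzWith.lipschitzOnWith_inv_smul {E : Type*} [NormedAddCommGroup E]
    [NormedSpace ℝ E] {g : E → ℝ} {K : ℝ≥0} (hg : LipschitzWith K g) {B c : ℝ≥0} (hc : 0 < c) :
    LipschitzOnWith (c⁻¹ + K * B / c ^ 2) (fun u => (g u)⁻¹ • u) {u | ‖u‖ ≤ B ∧ c ≤ g u} := by
  refine LipschitzOnWith.of_dist_le_mul ?_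
  rintro u ⟨-, hgu⟩ w ⟨hw, hgw⟩
  have hc' : (0 : ℝ) < c := hc
  have hu0 : 0 < g u := hc'.trans_le hgu
  have hw0 : 0 < g w := hc'.trans_le hgw
  have hsub : ‖g w - g u‖ ≤ K * ‖u - w‖ := by
    simpa [dist_eq_norm, norm_sub_rev u w] using hg.dist_le_mul w u
  have hinv : ‖(g u)⁻¹ - (g w)⁻¹‖ ≤ K * ‖u - w‖ / c ^ 2 := by
    rw [inv_sub_inv hu0.ne' hw0.ne', norm_div]
    refine div_le_div₀ (by positivity) hsub (by positivity) ?_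
    rw [Real.norm_of_nonneg (by positivity), sq]
    exact mul_le_mul hgu hgw hc'.le hu0.le
  have hsplit : (g u)⁻¹ • u - (g w)⁻¹ • w = (g u)⁻¹ • (u - w) + ((g u)⁻¹ - (g w)⁻¹) • w := by
    rw [smul_sub, sub_smul]; abel
  rw [dist_eq_norm, dist_eq_norm, hsplit]
  push_cast
  calc ‖(g u)⁻¹ • (u - w) + ((g u)⁻¹ - (g w)⁻¹) • w‖
      ≤ ‖(g u)⁻¹‖ * ‖u - w‖ + ‖(g u)⁻¹ - (g w)⁻¹‖ * ‖w‖ := by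
        simpa only [norm_smul] using norm_add_le ((g u)⁻¹ • (u - w)) (((g u)⁻¹ - (g w)⁻¹) • w)
    _ ≤ (c : ℝ)⁻¹ * ‖u - w‖ + K * ‖u - w‖ / c ^ 2 * B := by
        have : ‖(g u)⁻¹‖ ≤ (c : ℝ)⁻¹ := by
          rw [Real.norm_of_nonneg (by positivity)]
          exact inv_anti₀ hc' hgu
        gcongr
    _ = ((c : ℝ)⁻¹ + K * B / c ^ 2) * ‖u - w‖ := by ring

/-- The affine map placing `Fin m → ℝ` as the hyperplane `x i = s` of `ℝ^(m+1)`. -/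
def hyperplaneChart (m : ℕ) (i : Fin (m + 1)) (s : ℝ) (p : Fin m → ℝ) :
    EuclideanSpace ℝ (Fin (m + 1)) :=
  WithLp.toLp 2 (i.insertNth s p : Fin (m + 1) → ℝ)

theorem exists_lipschitzWith_hyperplaneChart (m : ℕ) (i : Fin (m + 1)) (s : ℝ) :
    ∃ K : ℝ≥0, LipschitzWith K (hyperplaneChart m i s) := by
  have h : LipschitzWith 1 (fun p : Fin m → ℝ => (i.insertNth s p : Fin (m + 1) → ℝ)) := by
    refine LipschitzWith.of_dist_le_mul fun p q => ?_
    rw [Fin.dist_insertNth_insertNth]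
    simp
  exact ⟨_, (PiLp.lipschitzWith_toLp 2 (fun _ : Fin (m + 1) => ℝ)).comp h⟩

/-- Scaling a nonzero vector by the inverse of its largest coordinate moves it to a face of the
cube `[-1, 1]^(m+1)`. -/
theorem exists_hyperplaneChart_eq_smul (m : ℕ) {y : EuclideanSpace ℝ (Fin (m + 1))} (hy : y ≠ 0) :
    ∃ t : ℝ, 0 < t ∧ ∃ i, ∃ s ∈ ({1, -1} : Set ℝ), ∃ p ∈ closedBall (0 : Fin m → ℝ) 1,
      hyperplaneChart m i s p = t⁻¹ • y := by
  obtain ⟨i, -, hi⟩ := Finset.exists_max_image Finset.univ (fun j => |y j|) Finset.univ_nonempty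
  have hpos : 0 < |y i| := by
    refine lt_of_not_ge fun h => hy ?_
    ext j
    exact abs_nonpos_iff.1 ((hi j (Finset.mem_univ j)).trans h)
  refine ⟨|y i|, hpos, i, |y i|⁻¹ * y i, ?_, fun j => |y i|⁻¹ * y (i.succAbove j), ?_, ?_⟩
  · rcases abs_choice (y i) with h | h
    · left
      rw [← h, abs_abs]
      exact inv_mul_cancel₀ hpos.ne'
    · right
      have : y i = -|y i| := by rw [h, neg_neg]
      rw [mem_singleton_iff]
      nth_rewrite 2 [this]
      rw [mul_neg, inv_mul_cancel₀ hpos.ne']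
  · rw [mem_closedBall_zero_iff, pi_norm_le_iff_of_nonneg zero_le_one]
    intro j
    rw [norm_mul, norm_inv, Real.norm_eq_abs, Real.norm_eq_abs, abs_abs,
      inv_mul_le_iff₀ hpos, mul_one]
    exact hi _ (Finset.mem_univ _)
  · ext j
    refine Fin.succAboveCases i ?_ (fun k => ?_) j <;> simp [hyperplaneChart]

theorem one_le_norm_hyperplaneChart (m : ℕ) (i : Fin (m + 1)) {s : ℝ}
    (hs : s ∈ ({1, -1} : Set ℝ)) (p : Fin m → ℝ) : 1 ≤ ‖hyperplaneChart m i s p‖ := by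
  have h := PiLp.norm_apply_le (hyperplaneChart m i s p) i
  have h1 : ‖hyperplaneChart m i s p i‖ = 1 := by
    rcases hs with rfl | rfl <;> simp [hyperplaneChart]
  rwa [h1] at h

/-- The boundary of a bounded convex neighbourhood of the origin is a Lipschitz image of the
boundary of a cube, so its codimension one Hausdorff measure is finite. -/
theorem hausdorffMeasure_frontier_lt_top_of_mem_nhds_zero (m : ℕ)
    {Ω : Set (EuclideanSpace ℝ (Fin (m + 1)))} (hbd : IsBounded Ω) (hconv : Convex ℝ Ω)
    (h0 : Ω ∈ 𝓝 0) : μH[(m : ℝ)] (frontier Ω) < ∞ := by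
  obtain ⟨K, hK⟩ := hconv.lipschitz_gauge h0
  obtain ⟨R, hR, hΩR⟩ := hbd.subset_closedBall_lt 0 0
  lift R to ℝ≥0 using hR.le
  have hface : ∀ i : Fin (m + 1), ∀ s ∈ ({1, -1} : Set ℝ),
      μH[(m : ℝ)] ((fun p => (gauge Ω (hyperplaneChart m i s p))⁻¹ • hyperplaneChart m i s p) ''
        closedBall (0 : Fin m → ℝ) 1) < ∞ := by
    intro i s hs
    obtain ⟨L, hL⟩ := exists_lipschitzWith_hyperplaneChart m i s
    obtain ⟨B, hB⟩ := ((isCompact_closedBall (0 : Fin m → ℝ) 1).image hL.continuous).isBounded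
      |>.exists_norm_le
    have hlip := (hK.lipschitzOnWith_inv_smul (B := B.toNNReal) (c := R⁻¹)
      (inv_pos.2 (by exact_mod_cast hR))).comp (hL.lipschitzOnWith (s := closedBall 0 1)) ?_
    · refine (hlip.hausdorffMeasure_image_le m.cast_nonneg).trans_lt ?_
      refine ENNReal.mul_lt_top (ENNReal.rpow_lt_top_of_nonneg m.cast_nonneg ENNReal.coe_ne_top) ?_
      have : (μH[(m : ℝ)] : Measure (Fin m → ℝ)) = volume := by
        simpa using hausdorffMeasure_pi_real (ι := Fin m)
      rw [this]
      exact measure_closedBall_lt_top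
    · intro p hp
      refine ⟨(hB _ (mem_image_of_mem _ hp)).trans (Real.le_coe_toNNReal B), ?_⟩
      refine le_trans ?_ (le_gauge_of_subset_closedBall (absorbent_nhds_zero h0) hR.le hΩR)
      rw [NNReal.coe_inv, ← one_div]
      exact div_le_div_of_nonneg_right (one_le_norm_hyperplaneChart m i hs p) hR.le
  have hcover : frontier Ω ⊆ ⋃ i : Fin (m + 1), ⋃ s ∈ ({1, -1} : Set ℝ),
      (fun p => (gauge Ω (hyperplaneChart m i s p))⁻¹ • hyperplaneChart m i s p) ''
        closedBall (0 : Fin m → ℝ) 1 := by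
    intro y hy
    have hgy : gauge Ω y = 1 := (gauge_eq_one_iff_mem_frontier hconv h0).2 hy
    have hy0 : y ≠ 0 := by
      rintro rfl
      simp at hgy
    obtain ⟨t, ht, i, s, hs, p, hp, hpy⟩ := exists_hyperplaneChart_eq_smul m hy0
    refine mem_iUnion.2 ⟨i, mem_iUnion₂.2 ⟨s, hs, p, hp, ?_⟩⟩
    simp only [hpy]
    rw [gauge_smul_of_nonneg (inv_nonneg.2 ht.le), hgy, smul_eq_mul, mul_one, inv_inv,
      smul_inv_smul₀ ht.ne']
  refine (measure_mono hcover).trans_lt ?_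
  refine (measure_iUnion_fintype_le _ _).trans_lt (ENNReal.sum_lt_top.2 fun i _ => ?_)
  exact measure_biUnion_lt_top (toFinite _) (hface i)

theorem hausdorffMeasure_frontier_lt_top (m : ℕ)
    {Ω : Set (EuclideanSpace ℝ (Fin (m + 1)))} (hbd : IsBounded Ω) (hconv : Convex ℝ Ω)
    (hint : (interior Ω).Nonempty) : μH[(m : ℝ)] (frontier Ω) < ∞ := by
  obtain ⟨x, hx⟩ := hint
  let e := IsometryEquiv.addLeft (-x)
  have hmem : e '' Ω ∈ 𝓝 0 := by
    have := e.toHomeomorph.isOpenMap.image_mem_nhds (mem_interior_iff_mem_nhds.1 hx)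
    simpa [e] using this
  have hfr : e '' frontier Ω = frontier (e '' Ω) := e.toHomeomorph.image_frontier Ω
  rw [← e.hausdorffMeasure_image, hfr]
  refine hausdorffMeasure_frontier_lt_top_of_mem_nhds_zero m ?_ ?_ hmem
  · exact e.isometry.lipschitz.isBounded_image hbd
  · exact hconv.translate (-x)

theorem norm_gradient_euclideanSpace_apply {n : ℕ} (i : Fin n) (x : EuclideanSpace ℝ (Fin n)) :
    ‖gradient (fun y : EuclideanSpace ℝ (Fin n) => y i) x‖ = 1 := by
  have h : HasGradientAt (fun y : EuclideanSpace ℝ (Fin n) => y i)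
      (EuclideanSpace.single i (1 : ℝ)) x := by
    rw [hasGradientAt_iff_hasFDerivAt]
    have hdual : InnerProductSpace.toDual ℝ _ (EuclideanSpace.single i (1 : ℝ)) =
        (EuclideanSpace.proj i : EuclideanSpace ℝ (Fin n) →L[ℝ] ℝ) := by
      ext y
      simp [EuclideanSpace.inner_single_left]
    rw [hdual]
    exact (EuclideanSpace.proj i : EuclideanSpace ℝ (Fin n) →L[ℝ] ℝ).hasFDerivAt
  rw [h.gradient]
  simp

theorem steklov_le_rayleigh {n : ℕ} {Ω : Set (EuclideanSpace ℝ (Fin n))}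
    {v : EuclideanSpace ℝ (Fin n) → ℝ} (hv : ContDiff ℝ 1 v)
    (hmean : (∫ x in frontier Ω, v x ∂μH[(n : ℝ) - 1]) = 0)
    (hpos : 0 < ∫ x in frontier Ω, (v x) ^ 2 ∂μH[(n : ℝ) - 1]) :
    steklov n Ω ≤ (∫ x in Ω, ‖gradient v x‖ ^ 2) /
      ∫ x in frontier Ω, (v x) ^ 2 ∂μH[(n : ℝ) - 1] := by
  refine csInf_le ⟨0, ?_⟩ ⟨v, hv, hmean, hpos, rfl⟩
  rintro r ⟨w, -, -, hw, rfl⟩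
  exact div_nonneg (integral_nonneg fun x => by positivity) hw.le

/-- if the boundary of `Ω` has barycenter at the origin, then
`σ(Ω) ≤ n V(Ω) / W(Ω)`. -/
theorem steklov_le_of_barycenter_zero (n : ℕ) (hn : 2 ≤ n)
    (Ω : Set (EuclideanSpace ℝ (Fin n)))
    (hbd : IsBounded Ω) (hop : IsOpen Ω) (hconv : Convex ℝ Ω)
    (hint : (interior Ω).Nonempty)
    (hbar : (∫ x in frontier Ω, x ∂μH[(n : ℝ) - 1]) = 0) :
    steklov n Ω ≤ (n : ℝ) * vol n Ω / bmom n Ω := by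
  obtain ⟨m, rfl⟩ : ∃ m, n = m + 1 := ⟨n - 1, by omega⟩
  have hd : ((m + 1 : ℕ) : ℝ) - 1 = m := by push_cast; ring
  have hm : (0 : ℝ) < m := by exact_mod_cast (by omega : 0 < m)
  set μ : Measure (EuclideanSpace ℝ (Fin (m + 1))) :=
    μH[((m + 1 : ℕ) : ℝ) - 1].restrict (frontier Ω) with hμ
  have hfin : μH[((m + 1 : ℕ) : ℝ) - 1] (frontier Ω) < ∞ := by
    rw [hd]
    exact hausdorffMeasure_frontier_lt_top m hbd hconv hint
  have hcpt : IsCompact (frontier Ω) := isCompact_of_isClosed_isBounded isClosed_frontier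
    (hbd.closure.subset frontier_subset_closure)
  have hI : ∀ {F : Type} [NormedAddCommGroup F] {f : EuclideanSpace ℝ (Fin (m + 1)) → F},
      Continuous f → Integrable f μ := fun hf =>
    hf.continuousOn.integrableOn_of_subset_isCompact hcpt isClosed_frontier.measurableSet
      subset_rfl hfin.ne
  have hsum : bmom (m + 1) Ω = ∑ i, ∫ x, (x i) ^ 2 ∂μ := by
    rw [← integral_finsetSum _ fun i _ => hI (by fun_prop)]
    simp only [bmom, EuclideanSpace.real_norm_sq_eq, hμ]
  have hmom_nonneg : 0 ≤ bmom (m + 1) Ω := integral_nonneg fun x => by positivity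
  rcases hmom_nonneg.eq_or_lt with hzero | hpos
  · have hae : ∀ᵐ x ∂μ, x = 0 := by
      have h := (integral_eq_zero_iff_of_nonneg (fun x => by positivity)
        (hI (by fun_prop : Continuous fun x => ‖x‖ ^ 2))).1 hzero.symm
      filter_upwards [h] with x hx
      simpa using hx
    have : NullSingletonClass (μH[((m + 1 : ℕ) : ℝ) - 1] :
        Measure (EuclideanSpace ℝ (Fin (m + 1)))) := by
      rw [hd]
      exact Measure.nullSingletonClass_hausdorff _ hm
    have hne : ∀ᵐ x ∂μ, x ≠ 0 := ae_restrict_of_ae (Measure.ae_ne _ 0)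
    have hμ0 : μ = 0 := ae_eq_bot.1 (Filter.eventually_false_iff_eq_bot.1
      ((hae.and hne).mono fun x hx => hx.2 hx.1))
    rw [← hzero, div_zero, steklov, ← hμ, hμ0]
    simp
  · have hcoord : ∀ i, steklov (m + 1) Ω * ∫ x, (x i) ^ 2 ∂μ ≤ vol (m + 1) Ω := by
      intro i
      have hnn : 0 ≤ ∫ x, (x i) ^ 2 ∂μ := integral_nonneg fun x => by positivity
      rcases hnn.eq_or_lt with h | h
      · rw [← h, mul_zero]
        exact ENNReal.toReal_nonneg
      · have hmean : ∫ x, x i ∂μ = 0 := by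
          have := (EuclideanSpace.proj i : EuclideanSpace ℝ (Fin (m + 1)) →L[ℝ] ℝ).integral_comp_comm
            (hI continuous_id)
          rw [show ∫ x, id x ∂μ = 0 from hbar, map_zero] at this
          exact this
        have hle := steklov_le_rayleigh (Ω := Ω) (v := fun x => x i) (by fun_prop) hmean h
        rw [le_div_iff₀ h] at hle
        simpa [norm_gradient_euclideanSpace_apply, vol, Measure.real] using hle
    rw [le_div_iff₀ hpos, hsum, Finset.mul_sum]
    simpa using Finset.sum_le_sum fun i (_ : i ∈ Finset.univ) => hcoord i
end
end
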